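/- arXiv:1403.3781 — 2 statements merged into one kernel-verified Lean document; each statement's English description precedes it below -/
import Mathlib

section
/- Let H be an infinite-dimensional complex Hilbert space and let F be a convex, positively homogeneous regular map of (k+1)-tuples of positive definite invertible bounded operators on H into self-adjoint bounded operators on H. Define G on k-tuples by G(A₁,…,Aₖ) = F(A₁,…,Aₖ,1), where 1 is the identity operator. Then F is the perspective of G; that is, F(A₁,…,Aₖ,A_{k+1}) = A_{k+1}^{1/2} G(A_{k+1}^{−1/2}A₁A_{k+1}^{−1/2}, …, A_{k+1}^{−1/2}AₖA_{k+1}^{−1/2}) A_{k+1}^{1/2} for all positive definite invertible operators A₁,…,A_{k+1}. -/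
set_option synthInstance.maxHeartbeats 400000
set_option maxHeartbeats 1000000

noncomputable section

variable {H : Type*} [NormedAddCommGroup H] [InnerProductSpace ℂ H] [CompleteSpace H]

/-- `a` is a positive definite invertible bounded operator. -/
def IsPosDefInv (a : H →L[ℂ] H) : Prop := 0 ≤ a ∧ IsUnit a

/-- `a` belongs to the compressed domain `D_p`: viewed as an operator on the range of the
projection `p`, it is positive definite and invertible, i.e. `a = p a p ≥ 0` and `a` is
invertible in the corner algebra `p B(H) p`. -/
def IsCornerPosDef (p a : H →L[ℂ] H) : Prop :=
  0 ≤ a ∧ p * a * p = a ∧ ∃ b : H →L[ℂ] H, p * b * p = b ∧ a * b = p ∧ b * a = p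

/-- A regular operator mapping of `k`-tuples of positive definite invertible bounded operators:
it is unitarily invariant and compatible with block diagonal decompositions with respect to
any pair of mutually orthogonal (self-adjoint idempotent) projections, the compressed tuples
lying in the compressed domains. -/
def IsRegularPD {k : ℕ} (F : (Fin k → (H →L[ℂ] H)) → (H →L[ℂ] H)) : Prop :=
  (∀ u ∈ unitary (H →L[ℂ] H), ∀ A : Fin k → (H →L[ℂ] H), (∀ i, IsPosDefInv (A i)) →
      F (fun i => star u * A i * u) = star u * F A * u) ∧
  (∀ p q : H →L[ℂ] H, IsSelfAdjoint p → IsIdempotentElem p →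
      IsSelfAdjoint q → IsIdempotentElem q → p * q = 0 →
      ∀ x y : Fin k → (H →L[ℂ] H),
        (∀ i, IsCornerPosDef p (p * x i * p)) → (∀ i, IsCornerPosDef q (q * y i * q)) →
        F (fun i => p * x i * p + q * y i * q) =
          p * F (fun i => p * x i * p) * p + q * F (fun i => q * y i * q) * q)

namespace IsPosDefInv

theorem of_le {a b : H →L[ℂ] H} (ha : IsPosDefInv a) (hab : a ≤ b) : IsPosDefInv b :=
  IsStrictlyPositive.of_le (A := H →L[ℂ] H) ha hab

theorem one : IsPosDefInv (1 : H →L[ℂ] H) := ⟨zero_le_one, isUnit_one⟩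

theorem smul {a : H →L[ℂ] H} (ha : IsPosDefInv a) {t : ℝ} (ht : 0 < t) : IsPosDefInv (t • a) :=
  ⟨smul_nonneg ht.le ha.1, (isUnit_smul_iff (Units.mk0 t ht.ne') a).2 ha.2⟩

theorem add {a b : H →L[ℂ] H} (ha : IsPosDefInv a) (hb : IsPosDefInv b) : IsPosDefInv (a + b) :=
  ha.of_le (le_add_of_nonneg_right hb.1)

theorem exists_smul_one_le {a : H →L[ℂ] H} (ha : IsPosDefInv a) :
    ∃ e : ℝ, 0 < e ∧ e • (1 : H →L[ℂ] H) ≤ a := by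
  rcases subsingleton_or_nontrivial (H →L[ℂ] H)
  · exact ⟨1, one_pos, (Subsingleton.elim _ _).le⟩
  obtain ⟨r, hr, h⟩ := (CFC.exists_pos_algebraMap_le_iff (A := H →L[ℂ] H) (a := a)
    (IsSelfAdjoint.of_nonneg ha.1)).2 fun x hx => by
      refine (spectrum_nonneg_of_nonneg ha.1 hx).lt_of_ne ?_
      rintro rfl
      exact spectrum.zero_notMem ℝ ha.2 hx
  exact ⟨r, hr, by rwa [Algebra.algebraMap_eq_smul_one] at h⟩

theorem conj {a c : H →L[ℂ] H} (ha : IsPosDefInv a) (hc : IsSelfAdjoint c) (hu : IsUnit c) :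
    IsPosDefInv (c * a * c) :=
  ⟨by simpa [hc.star_eq] using star_left_conjugate_nonneg ha.1 c, (hu.mul ha.2).mul hu⟩

/-- A `C*`-convex combination of positive definite invertible operators. -/
theorem add_conj {a b c d : H →L[ℂ] H} (ha : IsPosDefInv a) (hb : IsPosDefInv b)
    (h : star c * c + star d * d = 1) : IsPosDefInv (star c * a * c + star d * b * d) := by
  obtain ⟨e, he, hea⟩ := ha.exists_smul_one_le
  obtain ⟨f, hf, hfb⟩ := hb.exists_smul_one_le
  have hea' : min e f • (1 : H →L[ℂ] H) ≤ a :=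
    (smul_le_smul_of_nonneg_right (min_le_left e f) zero_le_one).trans hea
  have hfb' : min e f • (1 : H →L[ℂ] H) ≤ b :=
    (smul_le_smul_of_nonneg_right (min_le_right e f) zero_le_one).trans hfb
  refine (one.smul (lt_min he hf)).of_le ?_
  calc min e f • (1 : H →L[ℂ] H)
      = star c * (min e f • 1) * c + star d * (min e f • 1) * d := by
        simp only [mul_smul_comm, smul_mul_assoc, mul_one, ← smul_add, h]
    _ ≤ _ := add_le_add (star_left_conjugate_le_conjugate hea' c)
        (star_left_conjugate_le_conjugate hfb' d)

/-- The inverse of a positive definite invertible operator. -/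
theorem exists_inverse {a : H →L[ℂ] H} (ha : IsPosDefInv a) :
    ∃ b : H →L[ℂ] H, IsPosDefInv b ∧ a * b = 1 ∧ b * a = 1 := by
  obtain ⟨b, hab, hba⟩ := isUnit_iff_exists.1 ha.2
  have hsa : IsSelfAdjoint a := IsSelfAdjoint.of_nonneg ha.1
  have h1 : star b * a = 1 := by simpa [hsa.star_eq] using congrArg star hab
  have hb : IsSelfAdjoint b := by
    calc star b = star b * a * b := by rw [mul_assoc, hab, mul_one]
      _ = b := by rw [h1, one_mul]
  have h2 := ha.conj hb (isUnit_iff_exists.2 ⟨a, hba, hab⟩)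
  rw [hba, one_mul] at h2
  exact ⟨b, h2, hab, hba⟩

end IsPosDefInv

/-- An operator is nonnegative if its positive integer multiples are bounded below. -/
theorem nonneg_of_forall_nat_smul_add_nonneg {T K : H →L[ℂ] H}
    (h : ∀ m : ℕ, 0 ≤ ((m : ℝ) + 1) • T + K) : 0 ≤ T := by
  have h1 : ∀ m : ℕ, 0 ≤ T + ((m : ℝ) + 1)⁻¹ • K := fun m => by
    have h2 := smul_nonneg (inv_nonneg.2 (by positivity : (0 : ℝ) ≤ (m : ℝ) + 1)) (h m)
    rwa [smul_add, smul_smul, inv_mul_cancel₀ (by positivity), one_smul] at h2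
  have h3 : Filter.Tendsto (fun m : ℕ => T + ((m : ℝ) + 1)⁻¹ • K) Filter.atTop (nhds T) := by
    simpa using tendsto_const_nhds.add
      ((tendsto_one_div_add_atTop_nhds_zero_nat (𝕜 := ℝ)).smul_const K)
  exact ge_of_tendsto' h3 h1

/-- An operator is nonnegative if its compressions to all lines are. -/
theorem nonneg_of_forall_compression {T : H →L[ℂ] H}
    (h : ∀ x : H, ∃ p : H →L[ℂ] H, IsSelfAdjoint p ∧ p x = x ∧ 0 ≤ p * T * p) : 0 ≤ T := by
  rw [ContinuousLinearMap.nonneg_iff_isPositive, ContinuousLinearMap.isPositive_iff_complex]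
  intro x
  obtain ⟨p, hp, hx, hT⟩ := h x
  rw [ContinuousLinearMap.nonneg_iff_isPositive,
    ContinuousLinearMap.isPositive_iff_complex] at hT
  have h1 := hT x
  have h2 : inner ℂ ((p * T * p) x) x = inner ℂ (T x) x := by
    simp only [mul_apply_eq_comp, hx]
    have := hp.isSymmetric (T x) x
    simpa [hx] using this
  rwa [h2] at h1

/-- The off-diagonal part of `a` with respect to the decomposition by the idempotent `p`. -/
def offDiag {R : Type*} [Ring R] (p a : R) : R := p * a * (1 - p) + (1 - p) * a * p

theorem offDiag_add_pinch {R : Type*} [Ring R] (p a : R) :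
    p * a * p + (1 - p) * a * (1 - p) + offDiag p a = a := by
  unfold offDiag; noncomm_ring

section Chain

variable {a : H →L[ℂ] H} {p : ℕ → H →L[ℂ] H}

/-- The off-diagonal parts of a nonnegative operator along a chain of projections for which it is
block tridiagonal have sums bounded below independently of the length of the chain. -/
theorem le_sum_offDiag (ha : 0 ≤ a) {β : ℝ} (hβ : 0 ≤ β) (hab : a ≤ β • 1)
    (hsa : ∀ j, IsSelfAdjoint (p j)) (hid : ∀ j, IsIdempotentElem (p j))
    (hp : ∀ j, p (j + 1) * p j = p j)
    (hap : ∀ j, p (j + 1) * a * p j = a * p j) (m : ℕ) :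
    -((2 * β) • (1 : H →L[ℂ] H)) ≤ ∑ j ∈ Finset.range m, offDiag (p (j + 1)) a := by
  have hp' : ∀ j, p j * p (j + 1) = p j := fun j => by
    simpa [(hsa _).star_eq] using congrArg star (hp j)
  have hap' : ∀ j, p j * a * p (j + 1) = p j * a := fun j => by
    simpa [(hsa _).star_eq, (IsSelfAdjoint.of_nonneg ha).star_eq, mul_assoc]
      using congrArg star (hap j)
  have hp2 : ∀ j, p (j + 2) * a * p j = a * p j := fun j =>
    calc p (j + 2) * a * p j = p (j + 2) * (p (j + 1) * a * p j) := by rw [hap, mul_assoc]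
      _ = p (j + 2) * p (j + 1) * a * p j := by noncomm_ring
      _ = a * p j := by rw [hp (j + 1), hap]
  have hp2' : ∀ j, p j * a * p (j + 2) = p j * a := fun j => by
    simpa [(hsa _).star_eq, (IsSelfAdjoint.of_nonneg ha).star_eq, mul_assoc]
      using congrArg star (hp2 j)
  set q : ℕ → H →L[ℂ] H := fun j => p (j + 1) - p j with hq
  have hqsa : ∀ j, IsSelfAdjoint (q j) := fun j => (hsa _).sub (hsa _)
  have hqid : ∀ j, q j * q j = q j := fun j => by
    simp only [hq, sub_mul, mul_sub, (hid _).eq, hp, hp']; abel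
  have hoff : ∀ j, offDiag (p (j + 1)) a = q (j + 1) * a * q j + q j * a * q (j + 1) := fun j => by
    have e1 : (1 - p (j + 1)) * a * p (j + 1) = q (j + 1) * a * q j := by
      simp only [hq, sub_mul, mul_sub, one_mul, hap, hp2]; abel
    have e2 : p (j + 1) * a * (1 - p (j + 1)) = q j * a * q (j + 1) := by
      simp only [hq, sub_mul, mul_sub, mul_one, hap', hp2']; abel
    rw [offDiag, e1, e2, add_comm]
  have hqq : ∀ j, q j * a * q j ≤ β • q j := fun j => by
    have := (hqsa j).conjugate_le_conjugate hab
    rwa [mul_smul_comm, smul_mul_assoc, mul_one, hqid] at this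
  have hstep : ∀ j, -(β • (q j + q (j + 1))) ≤ offDiag (p (j + 1)) a := fun j => by
    have h1 : 0 ≤ (q j + q (j + 1)) * a * (q j + q (j + 1)) :=
      ((hqsa j).add (hqsa (j + 1))).conjugate_nonneg ha
    have h2 := add_le_add (hqq j) (hqq (j + 1))
    rw [hoff, neg_le_iff_add_nonneg, smul_add]
    calc (0 : H →L[ℂ] H) ≤ (q j + q (j + 1)) * a * (q j + q (j + 1)) := h1
      _ = q (j + 1) * a * q j + q j * a * q (j + 1)
          + (q j * a * q j + q (j + 1) * a * q (j + 1)) := by noncomm_ring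
      _ ≤ _ := add_le_add_right h2 _
  have hle1 : ∀ j, p j ≤ 1 := fun j => by
    have h : 0 ≤ (1 - p j) * 1 * (1 - p j) :=
      ((IsSelfAdjoint.one _).sub (hsa j)).conjugate_nonneg zero_le_one
    rw [mul_one, ((hid j).one_sub).eq] at h
    exact sub_nonneg.1 h
  have hnn : ∀ j, 0 ≤ p j := fun j => by
    have h : 0 ≤ p j * 1 * p j := (hsa j).conjugate_nonneg zero_le_one
    rwa [mul_one, (hid j).eq] at h
  have hsum : ∑ j ∈ Finset.range m, (q j + q (j + 1)) ≤ (2 : ℝ) • 1 := by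
    rw [Finset.sum_add_distrib, Finset.sum_range_sub p, Finset.sum_range_sub (fun j => p (j + 1)),
      two_smul]
    exact add_le_add ((sub_le_self _ (hnn 0)).trans (hle1 _))
      ((sub_le_self _ (hnn _)).trans (hle1 _))
  calc -((2 * β) • (1 : H →L[ℂ] H)) = -(β • ((2 : ℝ) • 1)) := by rw [smul_smul, mul_comm]
    _ ≤ -(β • ∑ j ∈ Finset.range m, (q j + q (j + 1))) :=
        neg_le_neg (smul_le_smul_of_nonneg_left hsum hβ)
    _ = ∑ j ∈ Finset.range m, -(β • (q j + q (j + 1))) := by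
        rw [Finset.smul_sum, Finset.sum_neg_distrib]
    _ ≤ _ := Finset.sum_le_sum fun j _ => hstep j

end Chain

section Pinching

variable {k : ℕ} {F : (Fin k → (H →L[ℂ] H)) → (H →L[ℂ] H)}

/-- Convexity of a map on tuples of positive definite invertible operators. -/
def IsConvexPD (F : (Fin k → (H →L[ℂ] H)) → (H →L[ℂ] H)) : Prop :=
  ∀ A B : Fin k → (H →L[ℂ] H), (∀ i, IsPosDefInv (A i)) → (∀ i, IsPosDefInv (B i)) →
    ∀ t : ℝ, 0 ≤ t → t ≤ 1 → F (fun i => t • A i + (1 - t) • B i) ≤ t • F A + (1 - t) • F B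

/-- Positive homogeneity of a map on tuples of positive definite invertible operators. -/
def IsHomogeneousPD (F : (Fin k → (H →L[ℂ] H)) → (H →L[ℂ] H)) : Prop :=
  ∀ t : ℝ, 0 < t → ∀ A : Fin k → (H →L[ℂ] H), (∀ i, IsPosDefInv (A i)) →
    F (fun i => t • A i) = t • F A

/-- Subadditivity of a map on tuples of positive definite invertible operators. -/
def IsSubadditivePD (F : (Fin k → (H →L[ℂ] H)) → (H →L[ℂ] H)) : Prop :=
  ∀ A B : Fin k → (H →L[ℂ] H), (∀ i, IsPosDefInv (A i)) → (∀ i, IsPosDefInv (B i)) →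
    F (fun i => A i + B i) ≤ F A + F B

theorem IsConvexPD.isSubadditivePD (hc : IsConvexPD F) (hh : IsHomogeneousPD F) :
    IsSubadditivePD F := fun A B hA hB => by
  have h2 : (0 : ℝ) < 2 := two_pos
  have h := hc _ _ (fun i => (hA i).smul h2) (fun i => (hB i).smul h2) (1 / 2) (by norm_num)
    (by norm_num)
  rw [hh 2 h2 A hA, hh 2 h2 B hB] at h
  norm_num [smul_smul] at h
  exact h

theorem IsSelfAdjoint.compl_mul_add {p : H →L[ℂ] H} (hp : IsSelfAdjoint p)
    (hi : IsIdempotentElem p) : star p * p + star (1 - p) * (1 - p) = 1 := by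
  rw [((IsSelfAdjoint.one _).sub hp).star_eq, hp.star_eq, hi.eq, hi.one_sub.eq]; abel

theorem IsPosDefInv.pinch {p a b : H →L[ℂ] H} (hp : IsSelfAdjoint p) (hi : IsIdempotentElem p)
    (ha : IsPosDefInv a) (hb : IsPosDefInv b) :
    IsPosDefInv (p * a * p + (1 - p) * b * (1 - p)) := by
  simpa only [((IsSelfAdjoint.one _).sub hp).star_eq, hp.star_eq] using
    ha.add_conj hb (hp.compl_mul_add hi)

theorem IsRegularPD.map_pinch_le (hF : IsRegularPD F) (hc : IsConvexPD F) {p : H →L[ℂ] H}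
    (hp : IsSelfAdjoint p) (hi : IsIdempotentElem p) {A : Fin k → (H →L[ℂ] H)}
    (hA : ∀ i, IsPosDefInv (A i)) :
    F (fun i => p * A i * p + (1 - p) * A i * (1 - p)) ≤
      p * F A * p + (1 - p) * F A * (1 - p) := by
  have hs : IsSelfAdjoint (2 * p - 1) := by
    rw [two_mul]; exact (hp.add hp).sub (IsSelfAdjoint.one _)
  have hss : (2 * p - 1) * (2 * p - 1) = 1 := by
    have : (2 * p - 1) * (2 * p - 1) = 4 * (p * p) - 4 * p + 1 := by noncomm_ring
    rw [this, hi.eq, sub_self, zero_add]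
  have key : ∀ a : H →L[ℂ] H, p * a * p + (1 - p) * a * (1 - p) =
      (1 / 2 : ℝ) • a + (1 - 1 / 2 : ℝ) • ((2 * p - 1) * a * (2 * p - 1)) := fun a => by
    have : a + (2 * p - 1) * a * (2 * p - 1) =
      (2 : ℝ) • (p * a * p + (1 - p) * a * (1 - p)) := by rw [two_smul]; noncomm_ring
    rw [show (1 - 1 / 2 : ℝ) = 1 / 2 by norm_num, ← smul_add, this, smul_smul]
    norm_num
  have hu : 2 * p - 1 ∈ unitary (H →L[ℂ] H) := by
    rw [Unitary.mem_iff, hs.star_eq]; exact ⟨hss, hss⟩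
  have hFu := hF.1 _ hu A hA
  rw [hs.star_eq] at hFu
  simp only [key]
  rw [← hFu]
  exact hc _ _ hA (fun i => (hA i).conj hs (isUnit_iff_exists.2 ⟨_, hss, hss⟩)) (1 / 2)
    (by norm_num) (by norm_num)

theorem isCornerPosDef_conj {v a : H →L[ℂ] H} (hv : star v * v = 1) (ha : IsPosDefInv a) :
    IsCornerPosDef (v * star v) (v * star v * (v * a * star v) * (v * star v)) := by
  have hv' : ∀ x, star v * (v * x) = x := fun x => by rw [← mul_assoc, hv, one_mul]
  obtain ⟨b, hb, hb'⟩ := isUnit_iff_exists.1 ha.2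
  have e : v * star v * (v * a * star v) * (v * star v) = v * a * star v := by
    simp only [mul_assoc, hv']
  have hb1 : ∀ x, a * (b * x) = x := fun x => by rw [← mul_assoc, hb, one_mul]
  have hb2 : ∀ x, b * (a * x) = x := fun x => by rw [← mul_assoc, hb', one_mul]
  rw [e]
  refine ⟨star_right_conjugate_nonneg ha.1 v, e, v * b * star v, ?_, ?_, ?_⟩ <;>
    simp only [mul_assoc, hv', hb1, hb2]

theorem isCornerPosDef_compression {p a : H →L[ℂ] H} (hp : IsSelfAdjoint p)
    (hi : IsIdempotentElem p) (ha : IsPosDefInv a) : IsCornerPosDef p (p * a * p) := by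
  have hq : (1 - p) * p = 0 := by rw [sub_mul, one_mul, hi.eq, sub_self]
  have hq' : p * (1 - p) = 0 := by rw [mul_sub, mul_one, hi.eq, sub_self]
  have hp1 : ∀ x, p * (p * x) = p * x := fun x => by rw [← mul_assoc, hi.eq]
  have hd := IsPosDefInv.pinch hp hi ha IsPosDefInv.one
  rw [mul_one, hi.one_sub.eq] at hd
  set d := p * a * p + (1 - p) with hdd
  obtain ⟨b, hb, hb'⟩ := isUnit_iff_exists.1 hd.2
  have hpd : p * d = p * a * p := by rw [hdd, mul_add, hq', add_zero, mul_assoc p a, hp1]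
  have hdp : d * p = p * a * p := by rw [hdd, add_mul, hq, add_zero, mul_assoc _ p, hi.eq]
  refine ⟨hp.conjugate_nonneg ha.1, by simp only [mul_assoc, hp1, hi.eq], p * b * p,
    by simp only [mul_assoc, hp1, hi.eq], ?_, ?_⟩
  · calc p * a * p * (p * b * p) = p * a * p * b * p := by simp only [mul_assoc, hp1]
      _ = p * (d * b) * p := by rw [← hpd]; simp only [mul_assoc]
      _ = p := by rw [hb, mul_one, hi.eq]
  · calc p * b * p * (p * a * p) = p * b * (p * a * p) := by simp only [mul_assoc, hp1]
      _ = p * (b * d) * p := by rw [← hdp]; simp only [mul_assoc]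
      _ = p := by rw [hb', mul_one, hi.eq]

/-- A positively homogeneous, subadditive map whose compression by a projection does not increase
when the arguments are replaced by block diagonal ones with the same block. -/
structure IsPinching (F : (Fin k → (H →L[ℂ] H)) → (H →L[ℂ] H)) : Prop where
  hom : IsHomogeneousPD F
  subadd : IsSubadditivePD F
  pinch : ∀ p : H →L[ℂ] H, IsSelfAdjoint p → IsIdempotentElem p →
    ∀ A X : Fin k → (H →L[ℂ] H), (∀ i, IsPosDefInv (A i)) → (∀ i, IsPosDefInv (X i)) →
      p * F (fun i => p * A i * p + (1 - p) * X i * (1 - p)) * p ≤ p * F A * p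

theorem IsRegularPD.isPinching (hF : IsRegularPD F) (hc : IsConvexPD F)
    (hh : IsHomogeneousPD F) : IsPinching F where
  hom := hh
  subadd := hc.isSubadditivePD hh
  pinch p hp hi A X hA hX := by
    have hq : (1 - p) * p = 0 := by rw [sub_mul, one_mul, hi.eq, sub_self]
    have hq' : p * (1 - p) = 0 := by rw [mul_sub, mul_one, hi.eq, sub_self]
    have hp1 : ∀ x, p * (p * x) = p * x := fun x => by rw [← mul_assoc, hi.eq]
    have hq1 : ∀ x, p * ((1 - p) * x) = 0 := fun x => by rw [← mul_assoc, hq', zero_mul]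
    have hsq := (IsSelfAdjoint.one (H →L[ℂ] H)).sub hp
    have block : ∀ Y : Fin k → (H →L[ℂ] H), (∀ i, IsPosDefInv (Y i)) →
        p * F (fun i => p * A i * p + (1 - p) * Y i * (1 - p)) * p =
          p * F (fun i => p * A i * p) * p := fun Y hY => by
      rw [hF.2 p (1 - p) hp hi hsq hi.one_sub hq' A Y
        (fun i => isCornerPosDef_compression hp hi (hA i))
        (fun i => isCornerPosDef_compression hsq hi.one_sub (hY i))]
      simp only [mul_add, mul_assoc, hp1, hq1, hi.eq, add_zero]
    rw [block X hX, ← block A hA]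
    have h := hp.conjugate_le_conjugate (hF.map_pinch_le hc hp hi hA)
    refine h.trans_eq ?_
    simp only [mul_add, mul_assoc, hp1, hq1, hi.eq, add_zero]

end Pinching

section Compress

variable {k : ℕ} {F : (Fin k → (H →L[ℂ] H)) → (H →L[ℂ] H)} {v w v' w' : H →L[ℂ] H}

/-- Two isometries whose ranges are complementary. -/
structure IsCuntzPair (v w : H →L[ℂ] H) : Prop where
  left : star v * v = 1
  right : star w * w = 1
  add_eq : v * star v + w * star w = 1

namespace IsCuntzPair

theorem symm (h : IsCuntzPair v w) : IsCuntzPair w v :=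
  ⟨h.right, h.left, by rw [add_comm, h.add_eq]⟩

theorem left_right (h : IsCuntzPair v w) : star v * w = 0 := by
  have e : star v * (v * star v + w * star w) * w = star v * w := by rw [h.add_eq, mul_one]
  have e' : star v * (v * star v + w * star w) * w =
      (star v * v) * star v * w + star v * w * (star w * w) := by noncomm_ring
  rw [e', h.left, h.right, one_mul, mul_one] at e
  exact add_eq_left.1 e

theorem right_left (h : IsCuntzPair v w) : star w * v = 0 := h.symm.left_right

theorem left_assoc (h : IsCuntzPair v w) (x : H →L[ℂ] H) : star v * (v * x) = x := by
  rw [← mul_assoc, h.left, one_mul]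

theorem right_assoc (h : IsCuntzPair v w) (x : H →L[ℂ] H) : star w * (w * x) = x :=
  h.symm.left_assoc x

theorem left_right_assoc (h : IsCuntzPair v w) (x : H →L[ℂ] H) : star v * (w * x) = 0 := by
  rw [← mul_assoc, h.left_right, zero_mul]

theorem right_left_assoc (h : IsCuntzPair v w) (x : H →L[ℂ] H) : star w * (v * x) = 0 :=
  h.symm.left_right_assoc x

theorem isPosDefInv (h : IsCuntzPair v w) {a b : H →L[ℂ] H} (ha : IsPosDefInv a)
    (hb : IsPosDefInv b) : IsPosDefInv (v * a * star v + w * b * star w) := by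
  simpa using ha.add_conj hb (c := star v) (d := star w) (by simpa using h.add_eq)

/-- Splitting the range of `v` along the pair. -/
theorem refine_left (h : IsCuntzPair v w) :
    IsCuntzPair (v * v) (v * w * star v + w * star w) := by
  refine ⟨?_, ?_, ?_⟩
  · simp only [star_mul, mul_assoc, h.left_assoc, h.left]
  · simp only [star_mul, star_add, star_star, mul_assoc, mul_add, add_mul, h.left_assoc,
      h.right_assoc, h.right_left_assoc, h.left_right_assoc, mul_zero, add_zero, zero_add,
      h.add_eq]
  · simp only [star_mul, star_add, star_star, mul_assoc, mul_add, add_mul, h.left_assoc,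
      h.right_assoc, h.right_left_assoc, h.left_right_assoc, mul_zero, add_zero, zero_add]
    rw [← add_assoc, ← mul_add, ← mul_assoc v, ← mul_assoc w, ← add_mul, h.add_eq, one_mul,
      h.add_eq]

/-- Splitting the range of `v` along the pair. -/
theorem refine_right (h : IsCuntzPair v w) :
    IsCuntzPair (v * w) (v * v * star v + w * star w) := by
  refine ⟨?_, ?_, ?_⟩
  · simp only [star_mul, mul_assoc, h.left_assoc, h.right]
  · simp only [star_mul, star_add, star_star, mul_assoc, mul_add, add_mul, h.left_assoc,
      h.right_assoc, h.right_left_assoc, h.left_right_assoc, mul_zero, add_zero, zero_add,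
      h.add_eq]
  · simp only [star_mul, star_add, star_star, mul_assoc, mul_add, add_mul, h.left_assoc,
      h.right_assoc, h.right_left_assoc, h.left_right_assoc, mul_zero, add_zero, zero_add]
    rw [← add_assoc, ← mul_add, ← mul_assoc v, ← mul_assoc w, ← add_mul, h.symm.add_eq, one_mul,
      h.add_eq]

end IsCuntzPair

/-- The map on tuples of operators obtained from `F` by identifying `H` with the range of the
isometry `v`. -/
def compress (F : (Fin k → (H →L[ℂ] H)) → (H →L[ℂ] H)) (v : H →L[ℂ] H)
    (A : Fin k → (H →L[ℂ] H)) : H →L[ℂ] H :=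
  star v * F (fun i => v * A i * star v) * v

variable {A B : Fin k → (H →L[ℂ] H)}

theorem IsRegularPD.map_add_isometry (hF : IsRegularPD F) (hv : star v * v = 1)
    (hw : star w * w = 1) (hvw : star v * w = 0) (hA : ∀ i, IsPosDefInv (A i))
    (hB : ∀ i, IsPosDefInv (B i)) :
    F (fun i => v * A i * star v + w * B i * star w) =
      v * compress F v A * star v + w * compress F w B * star w := by
  have hv' : ∀ x, star v * (v * x) = x := fun x => by rw [← mul_assoc, hv, one_mul]
  have hw' : ∀ x, star w * (w * x) = x := fun x => by rw [← mul_assoc, hw, one_mul]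
  have hvw' : ∀ x, star v * (w * x) = 0 := fun x => by rw [← mul_assoc, hvw, zero_mul]
  have h := hF.2 (v * star v) (w * star w) (IsSelfAdjoint.mul_star_self v)
    (by simp only [IsIdempotentElem, mul_assoc, hv']) (IsSelfAdjoint.mul_star_self w)
    (by simp only [IsIdempotentElem, mul_assoc, hw']) (by simp only [mul_assoc, hvw', mul_zero])
    (fun i => v * A i * star v) (fun i => w * B i * star w)
    (fun i => isCornerPosDef_conj hv (hA i)) (fun i => isCornerPosDef_conj hw (hB i))
  simpa only [compress, mul_assoc, hv', hw'] using h

theorem IsRegularPD.map_cuntz (hF : IsRegularPD F) (h : IsCuntzPair v w)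
    (hA : ∀ i, IsPosDefInv (A i)) (hB : ∀ i, IsPosDefInv (B i)) :
    F (fun i => v * A i * star v + w * B i * star w) =
      v * compress F v A * star v + w * compress F w B * star w :=
  hF.map_add_isometry h.left h.right h.left_right hA hB

theorem IsRegularPD.compress_eq (hF : IsRegularPD F) (h : IsCuntzPair v w)
    (h' : IsCuntzPair v' w') (hA : ∀ i, IsPosDefInv (A i)) :
    compress F v' A = compress F v A := by
  have hu : v * star v' + w * star w' ∈ unitary (H →L[ℂ] H) := by
    rw [Unitary.mem_iff]
    constructor <;>
    simp only [star_mul, star_add, star_star, mul_assoc, mul_add, add_mul, h.left_assoc,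
      h'.left_assoc, h.right_assoc, h'.right_assoc, h.right_left_assoc, h.left_right_assoc,
      h'.right_left_assoc, h'.left_right_assoc, mul_zero, add_zero, zero_add, h.add_eq, h'.add_eq]
  have e := hF.1 _ hu _ (fun i => h.isPosDefInv (hA i) (hA i))
  have e1 : ∀ a b : H →L[ℂ] H, star (v * star v' + w * star w') *
      (v * a * star v + w * b * star w) * (v * star v' + w * star w') =
        v' * a * star v' + w' * b * star w' := fun a b => by
    simp only [star_mul, star_add, star_star, mul_assoc, mul_add, add_mul, h.left_assoc,
      h.right_assoc, h.right_left_assoc, h.left_right_assoc, mul_zero, add_zero, zero_add]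
  simp only [e1] at e
  rw [hF.map_cuntz h hA hA, hF.map_cuntz h' hA hA, e1] at e
  have e2 := congrArg (fun x => star v' * x * v') e
  simpa only [mul_assoc, mul_add, add_mul, h'.left_assoc, h'.left, h'.left_right_assoc,
    h'.right_left, mul_one, mul_zero, add_zero, zero_mul] using e2

/-- A regular map agrees with its compression on block diagonal tuples with two infinite blocks. -/
theorem IsRegularPD.compress_cuntz (hF : IsRegularPD F) (h : IsCuntzPair v w)
    (hA : ∀ i, IsPosDefInv (A i)) (hB : ∀ i, IsPosDefInv (B i)) :
    compress F v (fun i => v * A i * star v + w * B i * star w) =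
      F (fun i => v * A i * star v + w * B i * star w) := by
  rw [hF.map_cuntz h hA hB, hF.compress_eq h h.symm hB]
  have e := hF.map_add_isometry h.refine_left.left h.refine_right.left
    (by simp only [star_mul, mul_assoc, h.left_assoc, h.left_right]) hA hB
  rw [hF.compress_eq h h.refine_left hA, hF.compress_eq h h.refine_right hB] at e
  simp only [star_mul, mul_assoc] at e
  rw [compress]
  simp only [mul_add, add_mul, mul_assoc]
  rw [e]
  simp only [mul_add, add_mul, mul_assoc, h.left_assoc, h.left, mul_one]

theorem IsRegularPD.compress_cuntz_add (hF : IsRegularPD F) (h : IsCuntzPair v w)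
    (hA : ∀ i, IsPosDefInv (A i)) (hB : ∀ i, IsPosDefInv (B i)) :
    F (fun i => v * A i * star v + w * B i * star w) =
      v * compress F v A * star v + w * compress F v B * star w := by
  rw [hF.map_cuntz h hA hB, hF.compress_eq h h.symm hB]

/-- Jensen's inequality for the compression of a convex regular map. -/
theorem IsRegularPD.compress_jensen (hF : IsRegularPD F) (hc : IsConvexPD F)
    (h : IsCuntzPair v w) {c e : H →L[ℂ] H} (hcs : IsSelfAdjoint c) (hes : IsSelfAdjoint e)
    (hce : c * e = e * c) (hsum : c * c + e * e = 1) (hA : ∀ i, IsPosDefInv (A i))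
    (hB : ∀ i, IsPosDefInv (B i)) :
    compress F v (fun i => c * A i * c + e * B i * e) ≤
      c * compress F v A * c + e * compress F v B * e := by
  obtain ⟨u, hu⟩ : ∃ u, u = v * c * star v + v * e * star w + w * e * star v - w * c * star w :=
    ⟨_, rfl⟩
  have hce' : ∀ x, c * (e * x) = e * (c * x) := fun x => by rw [← mul_assoc, hce, mul_assoc]
  have hcc : ∀ x, c * (c * x) + e * (e * x) = x := fun x => by
    rw [← mul_assoc, ← mul_assoc, ← add_mul, hsum, one_mul]
  have hus : IsSelfAdjoint u := by
    rw [IsSelfAdjoint, hu]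
    simp only [star_mul, star_add, star_sub, star_star, hcs.star_eq, hes.star_eq, mul_assoc]
    abel
  have huu : u * u = 1 := by
    have : u * u = v * (c * (c * star v) + e * (e * star v)) +
        w * (c * (c * star w) + e * (e * star w)) := by
      rw [hu]
      simp only [mul_assoc, mul_add, add_mul, mul_sub, sub_mul, h.left_assoc, h.right_assoc,
        h.right_left_assoc, h.left_right_assoc, mul_zero, add_zero, zero_add, sub_zero, hce']
      abel
    rw [this, hcc, hcc, h.add_eq]
  have huu' : u ∈ unitary (H →L[ℂ] H) := by
    rw [Unitary.mem_iff, hus.star_eq]; exact ⟨huu, huu⟩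
  have hM : ∀ i, IsPosDefInv (v * A i * star v + w * B i * star w) :=
    fun i => h.isPosDefInv (hA i) (hB i)
  have hFu := hF.1 u huu' _ hM
  rw [hF.compress_cuntz_add h hA hB, hus.star_eq] at hFu
  have hp1 : 1 - v * star v = w * star w := by rw [← h.add_eq, add_sub_cancel_left]
  have hpin := hF.map_pinch_le hc (IsSelfAdjoint.mul_star_self v)
    (by simp only [IsIdempotentElem, mul_assoc, h.left_assoc])
    (fun i => (hM i).conj hus (isUnit_iff_exists.2 ⟨_, huu, huu⟩))
  have huv : u * v = v * c + w * e := by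
    rw [hu]
    simp only [mul_assoc, add_mul, sub_mul, h.left, h.right_left, mul_one, mul_zero, add_zero,
      sub_zero]
  have huw : u * w = v * e - w * c := by
    rw [hu]
    simp only [mul_assoc, add_mul, sub_mul, h.right, h.left_right, mul_one, mul_zero, add_zero,
      zero_add]
  have huv' : ∀ x, u * (v * x) = v * (c * x) + w * (e * x) := fun x => by
    rw [← mul_assoc, huv, add_mul, mul_assoc, mul_assoc]
  have huw' : ∀ x, u * (w * x) = v * (e * x) - w * (c * x) := fun x => by
    rw [← mul_assoc, huw, sub_mul, mul_assoc, mul_assoc]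
  have hblock : ∀ a b : H →L[ℂ] H,
      v * star v * (u * (v * a * star v + w * b * star w) * u) * (v * star v) +
        (1 - v * star v) * (u * (v * a * star v + w * b * star w) * u) * (1 - v * star v) =
      v * (c * a * c + e * b * e) * star v + w * (e * a * e + c * b * c) * star w :=
    fun a b => by
    rw [hp1]
    simp only [mul_assoc, mul_add, add_mul, mul_sub, sub_mul, h.left_assoc, h.right_assoc,
      h.right_left_assoc, h.left_right_assoc, mul_zero, add_zero, zero_add, sub_zero, huv',
      huw', zero_sub, neg_mul, mul_neg, neg_neg]
  have hstar : star c * c + star e * e = 1 := by rw [hcs.star_eq, hes.star_eq, hsum]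
  have hstar' : star e * e + star c * c = 1 := by rw [add_comm, hstar]
  have hY : ∀ i, IsPosDefInv (c * A i * c + e * B i * e) := fun i => by
    simpa only [hcs.star_eq, hes.star_eq] using (hA i).add_conj (hB i) hstar
  have hY' : ∀ i, IsPosDefInv (e * A i * e + c * B i * c) := fun i => by
    simpa only [hcs.star_eq, hes.star_eq] using (hA i).add_conj (hB i) hstar'
  have hpin' : F (fun i => v * (c * A i * c + e * B i * e) * star v +
      w * (e * A i * e + c * B i * c) * star w) ≤
      v * (c * compress F v A * c + e * compress F v B * e) * star v +
      w * (e * compress F v A * e + c * compress F v B * c) * star w := by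
    rw [hFu] at hpin
    simp only [← hblock]
    exact hpin
  rw [hF.compress_cuntz_add h hY hY'] at hpin'
  have hfin := star_left_conjugate_le_conjugate hpin' v
  simpa only [mul_assoc, mul_add, add_mul, h.left_assoc, h.left, h.left_right_assoc,
    h.right_left, mul_one, mul_zero, add_zero, zero_mul] using hfin

end Compress

section CompressCongruence

variable {k : ℕ} {F : (Fin k → (H →L[ℂ] H)) → (H →L[ℂ] H)} {v w : H →L[ℂ] H}

theorem IsRegularPD.isHomogeneousPD_compress (hF : IsRegularPD F) (hh : IsHomogeneousPD F)
    (h : IsCuntzPair v w) : IsHomogeneousPD (compress F v) := fun t ht A hA => by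
  have e := hh t ht _ fun i => h.isPosDefInv (hA i) (hA i)
  have e1 : ∀ a : H →L[ℂ] H, t • (v * a * star v + w * a * star w) =
      v * (t • a) * star v + w * (t • a) * star w := fun a => by
    simp only [smul_add, smul_mul_assoc, mul_smul_comm]
  simp only [e1] at e
  rw [hF.compress_cuntz_add h (fun i => (hA i).smul ht) (fun i => (hA i).smul ht),
    hF.compress_cuntz_add h hA hA] at e
  have e2 := congrArg (fun x => star v * x * v) e
  simpa only [mul_assoc, mul_add, add_mul, h.left_assoc, h.left, h.left_right_assoc, h.right_left,
    mul_one, mul_zero, add_zero, zero_mul, smul_add, smul_mul_assoc, mul_smul_comm, smul_zero]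
    using e2

theorem IsRegularPD.isPinching_compress (hF : IsRegularPD F) (hc : IsConvexPD F)
    (hh : IsHomogeneousPD F) (h : IsCuntzPair v w) : IsPinching (compress F v) where
  hom := hF.isHomogeneousPD_compress hh h
  subadd A B hA hB := by
    have h2 : (0 : ℝ) < 2 := two_pos
    have hsq : √(1 / 2 : ℝ) * √(1 / 2) = 1 / 2 := Real.mul_self_sqrt (by norm_num)
    have hsq' : √(1 / 2 : ℝ) * (2 * √(1 / 2)) = 1 := by rw [mul_left_comm, hsq]; norm_num
    have hs : IsSelfAdjoint (√(1 / 2 : ℝ) • (1 : H →L[ℂ] H)) := (IsSelfAdjoint.all _).smul (.one _)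
    have hone : √(1 / 2 : ℝ) • (1 : H →L[ℂ] H) * √(1 / 2 : ℝ) • 1 +
        √(1 / 2 : ℝ) • (1 : H →L[ℂ] H) * √(1 / 2 : ℝ) • 1 = 1 := by
      rw [smul_mul_smul_comm, mul_one, hsq, ← add_smul]; norm_num
    have e := hF.compress_jensen hc h hs hs rfl hone (fun i => (hA i).smul h2)
      (fun i => (hB i).smul h2)
    rw [hF.isHomogeneousPD_compress hh h 2 h2 A hA,
      hF.isHomogeneousPD_compress hh h 2 h2 B hB] at e
    simp only [smul_mul_assoc, mul_smul_comm, one_mul, mul_one, smul_smul, hsq'] at e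
    simpa only [one_smul] using e
  pinch p hp hi A X hA hX := by
    have hq' : p * (1 - p) = 0 := by rw [mul_sub, mul_one, hi.eq, sub_self]
    have hp1 : ∀ x, p * (p * x) = p * x := fun x => by rw [← mul_assoc, hi.eq]
    have hq1 : ∀ x, p * ((1 - p) * x) = 0 := fun x => by rw [← mul_assoc, hq', zero_mul]
    have e := hF.compress_jensen hc h hp ((IsSelfAdjoint.one _).sub hp)
      (by rw [mul_sub, sub_mul, mul_one, one_mul])
      (by rw [hi.eq, hi.one_sub.eq, add_sub_cancel]) hA hX
    refine (hp.conjugate_le_conjugate e).trans_eq ?_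
    simp only [mul_add, mul_assoc, hp1, hq1, hi.eq, add_zero]

theorem IsRegularPD.compress_conj_le_of_one_sub (hF : IsRegularPD F) (hc : IsConvexPD F)
    (hh : IsHomogeneousPD F) (h : IsCuntzPair v w) {c : H →L[ℂ] H} (hcp : IsPosDefInv c)
    (h1 : IsPosDefInv (1 - c * c)) {A : Fin k → (H →L[ℂ] H)} (hA : ∀ i, IsPosDefInv (A i)) :
    compress F v (fun i => c * A i * c) ≤ c * compress F v A * c := by
  have hcs : IsSelfAdjoint c := IsSelfAdjoint.of_nonneg hcp.1
  have hhom := hF.isHomogeneousPD_compress hh h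
  set e := CFC.sqrt (1 - c * c) with he
  have hep : IsPosDefInv e :=
    ⟨CFC.sqrt_nonneg _, IsStrictlyPositive.isUnit_cfcSqrt (A := H →L[ℂ] H) _ h1⟩
  have hes : IsSelfAdjoint e := IsSelfAdjoint.of_nonneg hep.1
  have hee : c * c + e * e = 1 := by rw [he, CFC.sqrt_mul_sqrt_self _ h1.1]; abel
  have hce : c * e = e * c :=
    (Commute.cfcₙ_nnreal (show Commute (1 - c * c) c by
      rw [Commute, SemiconjBy]; noncomm_ring) NNReal.sqrt).eq.symm
  obtain ⟨d, hd, hed, hde⟩ := hep.exists_inverse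
  have hY : ∀ i, IsPosDefInv (c * A i * c) := fun i => (hA i).conj hcs hcp.2
  have hX : ∀ i, IsPosDefInv (d * (c * A i * c) * d) :=
    fun i => (hY i).conj (IsSelfAdjoint.of_nonneg hd.1) hd.2
  refine sub_nonneg.1 (nonneg_of_forall_nat_smul_add_nonneg
    (K := e * compress F v (fun i => d * (c * A i * c) * d) * e -
      compress F v (fun i => c * A i * c)) fun m => ?_)
  have hm : (0 : ℝ) < (m : ℝ) + 1 := by positivity
  have hJ := hF.compress_jensen hc h hcs hes hce hee (fun i => (hA i).smul hm) hX
  have harg : (fun i => c * (((m : ℝ) + 1) • A i) * c + e * (d * (c * A i * c) * d) * e) =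
      fun i => ((m : ℝ) + 1 + 1) • (c * A i * c) := funext fun i => by
    have : e * (d * (c * A i * c) * d) * e = (e * d) * (c * A i * c) * (d * e) := by
      simp only [mul_assoc]
    rw [this, hed, hde, one_mul, mul_one, add_smul ((m : ℝ) + 1) 1, one_smul, mul_smul_comm,
      smul_mul_assoc]
  rw [harg, hhom _ (by positivity) _ hY, hhom _ hm _ hA, mul_smul_comm, smul_mul_assoc] at hJ
  refine (sub_nonneg.2 hJ).trans_eq ?_
  module

theorem IsRegularPD.compress_conj_le (hF : IsRegularPD F) (hc : IsConvexPD F)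
    (hh : IsHomogeneousPD F) (h : IsCuntzPair v w) {c : H →L[ℂ] H} (hcp : IsPosDefInv c)
    {A : Fin k → (H →L[ℂ] H)} (hA : ∀ i, IsPosDefInv (A i)) :
    compress F v (fun i => c * A i * c) ≤ c * compress F v A * c := by
  have hcs : IsSelfAdjoint c := IsSelfAdjoint.of_nonneg hcp.1
  obtain ⟨t, ht, htc⟩ : ∃ t : ℝ, 0 < t ∧ ‖t • c‖ ≤ 1 / 2 := by
    refine ⟨(2 * (‖c‖ + 1))⁻¹, by positivity, ?_⟩
    rw [norm_smul, norm_inv, Real.norm_of_nonneg (by positivity), inv_mul_le_iff₀ (by positivity)]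
    linarith
  have h1 : IsPosDefInv (1 - (t • c) * (t • c)) := by
    have hs : IsSelfAdjoint ((t • c) * (t • c)) := by
      rw [IsSelfAdjoint, star_mul, star_smul, hcs.star_eq, star_trivial]
    have h2 := hs.le_algebraMap_norm_self
    have h3 : ‖(t • c) * (t • c)‖ ≤ 1 / 2 := 
      (norm_mul_le _ _).trans (by nlinarith [norm_nonneg (t • c)])
    rw [Algebra.algebraMap_eq_smul_one] at h2
    refine (IsPosDefInv.one.smul one_half_pos).of_le (le_sub_comm.1 ?_)
    refine (h2.trans (smul_le_smul_of_nonneg_right h3 zero_le_one)).trans_eq ?_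
    rw [eq_sub_iff_add_eq, ← add_smul]; norm_num
  have e := hF.compress_conj_le_of_one_sub hc hh h (hcp.smul ht) h1 hA
  simp only [smul_mul_assoc, mul_smul_comm, smul_smul] at e
  rw [hF.isHomogeneousPD_compress hh h _ (mul_pos ht ht) _ fun i => (hA i).conj hcs hcp.2] at e
  have e2 := smul_le_smul_of_nonneg_left e (inv_nonneg.2 (mul_pos ht ht).le)
  rwa [smul_smul, smul_smul, inv_mul_cancel₀ (mul_pos ht ht).ne', one_smul, one_smul] at e2

theorem IsRegularPD.compress_conj (hF : IsRegularPD F) (hc : IsConvexPD F)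
    (hh : IsHomogeneousPD F) (h : IsCuntzPair v w) {c : H →L[ℂ] H} (hcp : IsPosDefInv c)
    {A : Fin k → (H →L[ℂ] H)} (hA : ∀ i, IsPosDefInv (A i)) :
    compress F v (fun i => c * A i * c) = c * compress F v A * c := by
  have hcs : IsSelfAdjoint c := IsSelfAdjoint.of_nonneg hcp.1
  refine (hF.compress_conj_le hc hh h hcp hA).antisymm ?_
  obtain ⟨d, hd, hcd, hdc⟩ := hcp.exists_inverse
  have e := hF.compress_conj_le hc hh h hd fun i => (hA i).conj hcs hcp.2
  have harg : ∀ a : H →L[ℂ] H, d * (c * a * c) * d = a := fun a => by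
    have : d * (c * a * c) * d = (d * c) * a * (c * d) := by simp only [mul_assoc]
    rw [this, hdc, hcd, one_mul, mul_one]
  have harg' : ∀ a : H →L[ℂ] H, c * (d * a * d) * c = a := fun a => by
    have : c * (d * a * d) * c = (c * d) * a * (d * c) := by simp only [mul_assoc]
    rw [this, hdc, hcd, one_mul, mul_one]
  simp only [harg] at e
  exact (hcs.conjugate_le_conjugate e).trans_eq (harg' _)

end CompressCongruence

section Krylov

variable {k : ℕ} {E : Type*} [NormedAddCommGroup E] [InnerProductSpace ℂ E]

/-- The Krylov subspaces of a tuple of operators generated by a vector. -/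
def krylov (A : Fin k → (E →L[ℂ] E)) (x : E) : ℕ → Submodule ℂ E
  | 0 => Submodule.span ℂ {x}
  | j + 1 => krylov A x j ⊔ ⨆ i, (krylov A x j).map (A i : E →ₗ[ℂ] E)

instance finiteDimensional_krylov (A : Fin k → (E →L[ℂ] E)) (x : E) (j : ℕ) :
    FiniteDimensional ℂ (krylov A x j) := by
  induction j with
  | zero => rw [krylov]; infer_instance
  | succ j ih => rw [krylov]; infer_instance

theorem krylov_mono (A : Fin k → (E →L[ℂ] E)) (x : E) : Monotone (krylov A x) :=
  monotone_nat_of_le_succ fun j => by rw [krylov]; exact le_sup_left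

theorem map_mem_krylov_succ (A : Fin k → (E →L[ℂ] E)) (x : E) {y : E} {j : ℕ}
    (hy : y ∈ krylov A x j) (i : Fin k) : A i y ∈ krylov A x (j + 1) := by
  rw [krylov]
  exact le_sup_right (a := krylov A x j)
    (Submodule.mem_iSup_of_mem i (Submodule.mem_map_of_mem hy))

end Krylov

section Localization

variable {k : ℕ} {Ψ₁ Ψ₂ : (Fin k → (H →L[ℂ] H)) → (H →L[ℂ] H)} {A : Fin k → (H →L[ℂ] H)}

theorem IsSubadditivePD.map_sum_add_le (h : IsSubadditivePD Ψ₁) {X : ℕ → Fin k → (H →L[ℂ] H)}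
    {Y : Fin k → (H →L[ℂ] H)} (hX : ∀ j i, IsPosDefInv (X j i)) (hY : ∀ i, IsPosDefInv (Y i))
    (n : ℕ) :
    Ψ₁ (fun i => ∑ j ∈ Finset.range n, X j i + Y i) ≤
      ∑ j ∈ Finset.range n, Ψ₁ (X j) + Ψ₁ Y := by
  induction n with
  | zero => simp
  | succ n ih =>
    have hS : ∀ i, IsPosDefInv (∑ j ∈ Finset.range n, X j i + Y i) := fun i =>
      (hY i).of_le (le_add_of_nonneg_left (Finset.sum_nonneg fun j _ => (hX j i).1))
    simp only [Finset.sum_range_succ_comm, add_assoc]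
    exact (h _ _ (hX n) hS).trans (add_le_add_right ih _)

theorem IsPinching.compression_pinch_le (h₁ : IsPinching Ψ₁) (h₂ : IsPinching Ψ₂)
    (hA : ∀ i, IsPosDefInv (A i)) {p q : H →L[ℂ] H} (hp : IsSelfAdjoint p)
    (hpi : IsIdempotentElem p) (hq : IsSelfAdjoint q) (hpq : p * q = q)
    (heq : Ψ₁ (fun i => p * A i * p + (1 - p)) = Ψ₂ (fun i => p * A i * p + (1 - p))) :
    q * Ψ₁ (fun i => p * A i * p + (1 - p) * A i * (1 - p)) * q ≤ q * Ψ₂ A * q := by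
  have hqp : q * p = q := by simpa [hp.star_eq, hq.star_eq] using congrArg star hpq
  have hr : p * (1 - p) = 0 := by rw [mul_sub, mul_one, hpi.eq, sub_self]
  have hp1 : ∀ x, p * (p * x) = p * x := fun x => by rw [← mul_assoc, hpi.eq]
  have hA' : ∀ i, IsPosDefInv (p * A i * p + (1 - p)) := fun i => by
    simpa [hpi.one_sub.eq] using IsPosDefInv.pinch hp hpi (hA i) IsPosDefInv.one
  have e₁ := h₁.pinch p hp hpi _ A hA' hA
  have e₂ := h₂.pinch p hp hpi A (fun _ => 1) hA fun _ => IsPosDefInv.one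
  simp only [mul_one, hpi.one_sub.eq] at e₂
  have e₃ : ∀ i, p * (p * A i * p + (1 - p)) * p + (1 - p) * A i * (1 - p) =
      p * A i * p + (1 - p) * A i * (1 - p) := fun i => by
    rw [mul_add, hr, add_zero]; simp only [mul_assoc, hp1, hpi.eq]
  simp only [e₃] at e₁
  rw [heq] at e₁
  have e := hq.conjugate_le_conjugate (e₁.trans e₂)
  have e₄ : ∀ x, q * (p * x * p) * q = q * x * q := fun x => by
    calc q * (p * x * p) * q = (q * p) * x * (p * q) := by simp only [mul_assoc]
      _ = q * x * q := by rw [hpq, hqp]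
  simpa only [e₄] using e

/-- Two pinching maps which agree on block diagonal tuples along a chain of projections for which
the tuple `A` is block tridiagonal are comparable at `A`, compressed to the first projection. -/
theorem IsPinching.compression_sub_nonneg (h₁ : IsPinching Ψ₁) (h₂ : IsPinching Ψ₂)
    (hA : ∀ i, IsPosDefInv (A i)) {p : ℕ → H →L[ℂ] H} (hsa : ∀ j, IsSelfAdjoint (p j))
    (hid : ∀ j, IsIdempotentElem (p j)) (hp : ∀ i j, i ≤ j → p j * p i = p i)
    (hap : ∀ i j, p (j + 1) * A i * p j = A i * p j)
    (heq : ∀ j, Ψ₁ (fun i => p j * A i * p j + (1 - p j)) =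
      Ψ₂ (fun i => p j * A i * p j + (1 - p j))) :
    0 ≤ p 0 * (Ψ₂ A - Ψ₁ A) * p 0 := by
  obtain ⟨β, hβ, hAβ⟩ : ∃ β : ℝ, 0 ≤ β ∧ ∀ i, A i ≤ β • 1 := by
    refine ⟨∑ i, ‖A i‖, Finset.sum_nonneg fun i _ => norm_nonneg _, fun i => ?_⟩
    have h := (IsSelfAdjoint.of_nonneg (hA i).1).le_algebraMap_norm_self
    rw [Algebra.algebraMap_eq_smul_one] at h
    exact h.trans (smul_le_smul_of_nonneg_right
      (Finset.single_le_sum (f := fun i => ‖A i‖) (fun i _ => norm_nonneg _) (Finset.mem_univ i))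
      zero_le_one)
  set c : ℝ := 2 * β + 1 with hc
  have hc0 : 0 < c := by positivity
  obtain ⟨L, hL0, hL⟩ : ∃ L : ℝ, 0 ≤ L ∧ ∀ i, (c + 1) • 1 ≤ L • A i := by
    choose e he heA using fun i => (hA i).exists_smul_one_le
    refine ⟨∑ i, (c + 1) / e i, Finset.sum_nonneg fun i _ => by have := he i; positivity,
      fun i => ?_⟩
    have h1 : (c + 1) / e i ≤ ∑ i, (c + 1) / e i :=
      Finset.single_le_sum (f := fun i => (c + 1) / e i)
        (fun i _ => by have := he i; positivity) (Finset.mem_univ i)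
    refine le_trans ?_ (smul_le_smul_of_nonneg_right h1 (hA i).1)
    have h2 := smul_le_smul_of_nonneg_left (heA i)
      (show 0 ≤ (c + 1) / e i by have := he i; positivity)
    rwa [smul_smul, div_mul_cancel₀ _ (he i).ne'] at h2
  have hcD : ∀ _ : Fin k, IsPosDefInv (c • (1 : H →L[ℂ] H)) := fun _ => IsPosDefInv.one.smul hc0
  have hLD : ∀ i, IsPosDefInv (L • A i - c • 1) := fun i => by
    refine IsPosDefInv.one.of_le (le_sub_iff_add_le.2 ?_)
    have := hL i
    rwa [add_smul, one_smul, add_comm] at this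
  refine nonneg_of_forall_nat_smul_add_nonneg
    (K := p 0 * Ψ₁ (fun i => L • A i - c • 1) * p 0 + p 0 * Ψ₁ (fun _ => c • 1) * p 0 -
      L • (p 0 * Ψ₁ A * p 0)) fun m => ?_
  set O : Fin k → (H →L[ℂ] H) := fun i => ∑ j ∈ Finset.range (m + 1), offDiag (p (j + 1)) (A i)
    with hO
  have hOD : ∀ i, IsPosDefInv (c • 1 + O i) := fun i => by
    have h := le_sum_offDiag (hA i).1 hβ (hAβ i) hsa hid (fun j => hp j (j + 1) j.le_succ)
      (hap i) (m + 1)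
    refine IsPosDefInv.one.of_le ?_
    rw [hc, add_smul, one_smul, add_comm _ (1 : H →L[ℂ] H), add_assoc]
    exact le_add_of_nonneg_right (neg_le_iff_add_nonneg'.1 h)
  have hO0 : ∀ i, O i * p 0 = 0 := fun i => by
    rw [hO, Finset.sum_mul]
    refine Finset.sum_eq_zero fun j _ => ?_
    have e1 : p (j + 1) * p 0 = p 0 := hp 0 (j + 1) (Nat.zero_le _)
    have e2 : p (j + 1) * A i * p 0 = A i * p 0 :=
      calc p (j + 1) * A i * p 0 = p (j + 1) * (p (0 + 1) * A i * p 0) := by rw [hap, mul_assoc]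
        _ = p (j + 1) * p (0 + 1) * A i * p 0 := by simp only [mul_assoc]
        _ = A i * p 0 := by rw [hp (0 + 1) (j + 1) (by omega), hap]
    calc offDiag (p (j + 1)) (A i) * p 0
        = p (j + 1) * A i * p 0 - p (j + 1) * A i * (p (j + 1) * p 0) +
          (A i * (p (j + 1) * p 0) - p (j + 1) * A i * (p (j + 1) * p 0)) := by
          unfold offDiag; noncomm_ring
      _ = 0 := by rw [e1, e2]; abel
  have hO0' : ∀ i, p 0 * O i = 0 := fun i => by
    have hOs : IsSelfAdjoint (O i) := by
      have h := (IsSelfAdjoint.of_nonneg (hOD i).1).sub (IsSelfAdjoint.of_nonneg (hcD i).1)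
      rwa [add_sub_cancel_left] at h
    simpa [hOs.star_eq, (hsa 0).star_eq] using congrArg star (hO0 i)
  have hXD : ∀ j i, IsPosDefInv (p (j + 1) * A i * p (j + 1) +
      (1 - p (j + 1)) * A i * (1 - p (j + 1))) :=
    fun j i => IsPosDefInv.pinch (hsa _) (hid _) (hA i) (hA i)
  have hm : (0 : ℝ) < (m : ℝ) + 1 + L := by positivity
  have hsum : (fun i => ((m : ℝ) + 1 + L) • A i) = fun i =>
      ∑ j ∈ Finset.range (m + 1), (p (j + 1) * A i * p (j + 1) +
        (1 - p (j + 1)) * A i * (1 - p (j + 1))) + ((L • A i - c • 1) + (c • 1 + O i)) :=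
    funext fun i => by
      have h : ∑ j ∈ Finset.range (m + 1), (p (j + 1) * A i * p (j + 1) +
        (1 - p (j + 1)) * A i * (1 - p (j + 1))) + O i = ((m : ℝ) + 1) • A i := by
        rw [hO, ← Finset.sum_add_distrib]
        simp only [offDiag_add_pinch, Finset.sum_const, Finset.card_range]
        rw [← Nat.cast_smul_eq_nsmul ℝ, Nat.cast_succ]
      rw [add_smul, ← h]; abel
  have hsub := h₁.subadd.map_sum_add_le hXD (fun i => (hLD i).add (hOD i)) (m + 1)
  rw [← hsum, h₁.hom _ hm A hA] at hsub
  have hsub' := (hsa 0).conjugate_le_conjugate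
    (hsub.trans (add_le_add_right (h₁.subadd _ _ hLD hOD) _))
  have hcO := h₁.pinch (p 0) (hsa 0) (hid 0) _ _ hcD hOD
  have hcO' : ∀ i, p 0 * (c • 1) * p 0 + (1 - p 0) * (c • 1 + O i) * (1 - p 0) =
      c • 1 + O i := fun i => by
    have h : (1 - p 0) * O i * (1 - p 0) = O i := by
      simp only [sub_mul, mul_sub, hO0, hO0', one_mul, mul_one, sub_zero]
    rw [mul_add, add_mul, h, mul_smul_comm, mul_smul_comm, smul_mul_assoc, smul_mul_assoc, mul_one,
      mul_one, (hid 0).eq, (hid 0).one_sub.eq]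
    module
  simp only [hcO'] at hcO
  have hterm : ∀ j, p 0 * Ψ₁ (fun i => p (j + 1) * A i * p (j + 1) +
      (1 - p (j + 1)) * A i * (1 - p (j + 1))) * p 0 ≤ p 0 * Ψ₂ A * p 0 := fun j =>
    h₁.compression_pinch_le h₂ hA (hsa _) (hid _) (hsa 0) (hp 0 _ (Nat.zero_le _)) (heq _)
  have hterms := Finset.sum_le_sum (s := Finset.range (m + 1)) fun j _ => hterm j
  rw [Finset.sum_const, Finset.card_range, ← Nat.cast_smul_eq_nsmul ℝ, Nat.cast_succ] at hterms
  simp only [mul_add, add_mul, Finset.mul_sum, Finset.sum_mul, mul_smul_comm, smul_mul_assoc]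
    at hsub'
  have hfin := sub_nonneg.2 (hsub'.trans (add_le_add hterms (add_le_add_right hcO _)))
  refine hfin.trans_eq ?_
  rw [mul_sub, sub_mul]
  module

/-- Pinching maps are determined by their values on finite-rank perturbations of the identity. -/
theorem IsPinching.le_of_eq_finiteDimensional (h₁ : IsPinching Ψ₁) (h₂ : IsPinching Ψ₂)
    (heq : ∀ (N : Submodule ℂ H) [FiniteDimensional ℂ N] (A : Fin k → (H →L[ℂ] H)),
      (∀ i, IsPosDefInv (A i)) →
      Ψ₁ (fun i => N.starProjection * A i * N.starProjection + (1 - N.starProjection)) =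
        Ψ₂ (fun i => N.starProjection * A i * N.starProjection + (1 - N.starProjection)))
    (hA : ∀ i, IsPosDefInv (A i)) : Ψ₁ A ≤ Ψ₂ A := by
  refine sub_nonneg.1 (nonneg_of_forall_compression fun x => ?_)
  refine ⟨(krylov A x 0).starProjection, isSelfAdjoint_starProjection _,
    Submodule.starProjection_eq_self_iff.2 ?_, ?_⟩
  · rw [krylov]; exact Submodule.mem_span_singleton_self x
  refine h₁.compression_sub_nonneg h₂ hA (p := fun j => (krylov A x j).starProjection)
    (fun j => isSelfAdjoint_starProjection _) (fun j => Submodule.isIdempotentElem_starProjection _)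
    (fun i j hij => ?_) (fun i j => ?_) (fun j => heq (krylov A x j) A hA)
  · ext y
    exact Submodule.starProjection_eq_self_iff.2
      (krylov_mono A x hij (Submodule.starProjection_apply_mem _ y))
  · ext y
    exact Submodule.starProjection_eq_self_iff.2
      (map_mem_krylov_succ A x (Submodule.starProjection_apply_mem _ y) i)

end Localization

section Existence

/-- An infinite type is equivalent to two copies of itself, with any given finite subset contained
in the first copy. -/
theorem exists_equiv_sum_of_finite {ι : Type*} [Infinite ι] (s : Set ι) (hs : s.Finite) :
    ∃ e : ι ≃ ι ⊕ ι, ∀ i ∈ s, ∃ j, e i = Sum.inl j := by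
  classical
  have : Infinite ↥sᶜ := hs.infinite_compl.to_subtype
  have hcard : Cardinal.mk ↥sᶜ = Cardinal.mk ι := Cardinal.mk_compl_of_infinite s
    ((Cardinal.lt_aleph0_iff_set_finite.2 hs).trans_le (Cardinal.aleph0_le_mk ι))
  obtain ⟨e₀⟩ : Nonempty (↥sᶜ ≃ ↥sᶜ ⊕ ι) := by
    rw [← Cardinal.eq, Cardinal.mk_sum, Cardinal.lift_id, Cardinal.lift_id, hcard,
      Cardinal.add_eq_self (Cardinal.aleph0_le_mk ι)]
  refine ⟨(Equiv.Set.sumCompl s).symm.trans <| ((Equiv.refl _).sumCongr e₀).trans <|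
    (Equiv.sumAssoc _ _ _).symm.trans <| (Equiv.Set.sumCompl s).sumCongr (Equiv.refl _),
    fun i hi => ⟨i, ?_⟩⟩
  simp [Equiv.Set.sumCompl_symm_apply_of_mem hi]

theorem HilbertBasis.eq_zero_of_forall_inner {ι E : Type*} [NormedAddCommGroup E] [InnerProductSpace ℂ E]
    (b : HilbertBasis ι ℂ E) {x : E} (h : ∀ i, inner ℂ (b i) x = 0) : x = 0 := by
  apply b.repr.injective
  ext i
  rw [b.repr_apply_apply, h i, map_zero]; rfl

theorem HilbertBasis.clm_ext {ι E : Type*} [NormedAddCommGroup E] [InnerProductSpace ℂ E]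
    (b : HilbertBasis ι ℂ E) {S T : E →L[ℂ] E}
    (h : ∀ i, S (b i) = T (b i)) : S = T := by
  refine ContinuousLinearMap.ext_on (s := Set.range b) ?_ ?_
  · rw [dense_iff_closure_eq, ← Submodule.topologicalClosure_coe, b.dense_span]; rfl
  · rintro _ ⟨i, rfl⟩; exact h i

variable {ι : Type*} (b : HilbertBasis ι ℂ H)

/-- An injection of the index set of a Hilbert basis induces an isometry. -/
theorem HilbertBasis.exists_isometry {f : ι → ι} (hf : Function.Injective f) :
    ∃ v : H →L[ℂ] H, star v * v = 1 ∧ ∀ i, v (b i) = b (f i) := by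
  classical
  have ho : Orthonormal ℂ (b ∘ f) := b.orthonormal.comp f hf
  let V : H →ₗᵢ[ℂ] H := ho.orthogonalFamily.linearIsometry.comp b.repr.toLinearIsometry
  refine ⟨V.toContinuousLinearMap, ?_, fun i => ?_⟩
  · exact ContinuousLinearMap.norm_map_iff_adjoint_comp_self _ |>.1 V.norm_map
  · change ho.orthogonalFamily.linearIsometry (b.repr (b i)) = b (f i)
    rw [b.repr_self, OrthogonalFamily.linearIsometry_apply_single]
    simp

theorem HilbertBasis.exists_isCuntzPair [Infinite ι] (s : Set ι) (hs : s.Finite) :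
    ∃ v w : H →L[ℂ] H, IsCuntzPair v w ∧ ∀ i ∈ s, star w (b i) = 0 := by
  classical
  obtain ⟨e, he⟩ := exists_equiv_sum_of_finite s hs
  obtain ⟨v, hv, hvb⟩ := b.exists_isometry (f := fun i => e.symm (Sum.inl i))
    (e.symm.injective.comp Sum.inl_injective)
  obtain ⟨w, hw, hwb⟩ := b.exists_isometry (f := fun i => e.symm (Sum.inr i))
    (e.symm.injective.comp Sum.inr_injective)
  have hwv : ∀ i, star w (b (e.symm (Sum.inl i))) = 0 := fun i => by
    refine b.eq_zero_of_forall_inner fun l => ?_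
    rw [ContinuousLinearMap.star_eq_adjoint, ContinuousLinearMap.adjoint_inner_right, hwb]
    exact b.orthonormal.2 fun h => by simpa using e.symm.injective h
  have hvw : ∀ i, star v (b (e.symm (Sum.inr i))) = 0 := fun i => by
    refine b.eq_zero_of_forall_inner fun l => ?_
    rw [ContinuousLinearMap.star_eq_adjoint, ContinuousLinearMap.adjoint_inner_right, hvb]
    exact b.orthonormal.2 fun h => by simpa using e.symm.injective h
  have hvv : ∀ x, star v (v x) = x := fun x => by
    rw [← mul_apply_eq_comp, hv]; rfl
  have hww : ∀ x, star w (w x) = x := fun x => by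
    rw [← mul_apply_eq_comp, hw]; rfl
  refine ⟨v, w, ⟨hv, hw, b.clm_ext fun i => ?_⟩, fun i hi => ?_⟩
  · change v (star v (b i)) + w (star w (b i)) = b i
    rcases h : e i with j | j <;> obtain rfl := e.eq_symm_apply.2 h
    · rw [hwv, ← hvb, hvv, map_zero, add_zero]
    · rw [hvw, ← hwb, hww, map_zero, zero_add]
  · obtain ⟨j, hj⟩ := he i hi
    rw [e.eq_symm_apply.2 hj, hwv]

theorem exists_isCuntzPair (hH : ¬ FiniteDimensional ℂ H) (N : Submodule ℂ H)
    [FiniteDimensional ℂ N] :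
    ∃ v w : H →L[ℂ] H, IsCuntzPair v w ∧ star w * N.starProjection = 0 := by
  have ho : Orthonormal ℂ (fun i => (stdOrthonormalBasis ℂ N i : H)) :=
    (stdOrthonormalBasis ℂ N).orthonormal.comp_linearIsometry N.subtypeₗᵢ
  obtain ⟨t, b, hst, hb⟩ := ho.toSubtypeRange.exists_hilbertBasis_extension
  have ht : Infinite t := by
    by_contra hfin
    have : Finite t := not_infinite_iff_finite.1 hfin
    have hd := b.dense_span
    have : FiniteDimensional ℂ (Submodule.span ℂ (Set.range b)) :=
      FiniteDimensional.span_of_finite ℂ (Set.finite_range b)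
    rw [(Submodule.closed_of_finiteDimensional _).submodule_topologicalClosure_eq] at hd
    exact hH (Module.finite_def.2 (hd ▸ (Submodule.fg_span (Set.finite_range b))))
  obtain ⟨v, w, h, hw⟩ := b.exists_isCuntzPair
    (Subtype.val ⁻¹' Set.range fun i => (stdOrthonormalBasis ℂ N i : H))
    ((Set.finite_range _).preimage Subtype.val_injective.injOn)
  refine ⟨v, w, h, ?_⟩
  have hwi : ∀ i, star w (stdOrthonormalBasis ℂ N i : H) = 0 := fun i => by
    have := hw ⟨_, hst ⟨i, rfl⟩⟩ ⟨i, rfl⟩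
    rwa [hb] at this
  have hN : ∀ x : N, star w (x : H) = 0 := fun x => by
    rw [← (stdOrthonormalBasis ℂ N).sum_repr x]
    simp [hwi]
  ext y
  exact hN ⟨_, Submodule.starProjection_apply_mem _ y⟩

end Existence

section Perspective

variable {k : ℕ} {F : (Fin k → (H →L[ℂ] H)) → (H →L[ℂ] H)} {v w : H →L[ℂ] H}

theorem IsRegularPD.compress_eq_of_finiteDimensional (hF : IsRegularPD F)
    (hH : ¬ FiniteDimensional ℂ H) (h : IsCuntzPair v w) (N : Submodule ℂ H)
    [FiniteDimensional ℂ N] {A : Fin k → (H →L[ℂ] H)} (hA : ∀ i, IsPosDefInv (A i)) :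
    compress F v (fun i => N.starProjection * A i * N.starProjection + (1 - N.starProjection)) =
      F (fun i => N.starProjection * A i * N.starProjection + (1 - N.starProjection)) := by
  obtain ⟨v', w', h', hwp⟩ := exists_isCuntzPair hH N
  have hp : IsSelfAdjoint N.starProjection := isSelfAdjoint_starProjection N
  have hi : IsIdempotentElem N.starProjection := N.isIdempotentElem_starProjection
  generalize N.starProjection = p at *
  have hpw : p * w' = 0 := by simpa [hp.star_eq] using congrArg star hwp
  have hX : ∀ i, IsPosDefInv (p * A i * p + (1 - p)) := fun i => by
    simpa [hi.one_sub.eq] using IsPosDefInv.pinch hp hi (hA i) IsPosDefInv.one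
  have hpv : p * (v' * star v') = p := by
    rw [eq_sub_of_add_eq h'.add_eq, mul_sub, ← mul_assoc, hpw, zero_mul, sub_zero, mul_one]
  have hvp : v' * star v' * p = p := by
    simpa [hp.star_eq] using congrArg star hpv
  have hq : v' * star v' * (1 - p) * (v' * star v') = v' * star v' - p := by
    rw [mul_sub, mul_one, hvp, sub_mul, hpv]
    simp only [mul_assoc, h'.left_assoc]
  have hXe : (fun i => p * A i * p + (1 - p)) = fun i =>
      v' * (star v' * (p * A i * p + (1 - p)) * v') * star v' + w' * 1 * star w' :=
    funext fun i => by
      calc p * A i * p + (1 - p)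
          = p * A i * p + (v' * star v' - p) + w' * star w' := by rw [← h'.add_eq]; abel
        _ = (v' * star v' * p) * A i * (p * (v' * star v')) +
            v' * star v' * (1 - p) * (v' * star v') + w' * star w' := by rw [hvp, hpv, hq]
        _ = _ := by simp only [mul_add, add_mul, mul_assoc, mul_one]
  have hY : ∀ i, IsPosDefInv (star v' * (p * A i * p + (1 - p)) * v') := fun i => by
    obtain ⟨e, he, hea⟩ := (hX i).exists_smul_one_le
    refine (IsPosDefInv.one.smul he).of_le ?_
    refine le_trans (le_of_eq ?_) (star_left_conjugate_le_conjugate hea v')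
    rw [mul_smul_comm, smul_mul_assoc, mul_one, h'.left]
  rw [hF.compress_eq h' h hX, hXe]
  exact hF.compress_cuntz h' hY fun _ => IsPosDefInv.one

theorem IsRegularPD.compress_eq_self (hF : IsRegularPD F) (hc : IsConvexPD F)
    (hh : IsHomogeneousPD F) (hH : ¬ FiniteDimensional ℂ H) (h : IsCuntzPair v w)
    {A : Fin k → (H →L[ℂ] H)} (hA : ∀ i, IsPosDefInv (A i)) : compress F v A = F A :=
  le_antisymm
    ((hF.isPinching_compress hc hh h).le_of_eq_finiteDimensional (hF.isPinching hc hh)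
      (fun N _ _ hA => hF.compress_eq_of_finiteDimensional hH h N hA) hA)
    ((hF.isPinching hc hh).le_of_eq_finiteDimensional (hF.isPinching_compress hc hh h)
      (fun N _ _ hA => (hF.compress_eq_of_finiteDimensional hH h N hA).symm) hA)

/-- Convex, positively homogeneous regular maps are invariant under congruence. -/
theorem IsRegularPD.map_conj (hF : IsRegularPD F) (hc : IsConvexPD F)
    (hh : IsHomogeneousPD F) (hH : ¬ FiniteDimensional ℂ H) {c : H →L[ℂ] H} (hcp : IsPosDefInv c)
    {A : Fin k → (H →L[ℂ] H)} (hA : ∀ i, IsPosDefInv (A i)) :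
    F (fun i => c * A i * c) = c * F A * c := by
  obtain ⟨v, w, h, -⟩ := exists_isCuntzPair hH ⊥
  rw [← hF.compress_eq_self hc hh hH h hA, ← hF.compress_conj hc hh h hcp hA,
    hF.compress_eq_self hc hh hH h fun i => (hA i).conj (IsSelfAdjoint.of_nonneg hcp.1) hcp.2]

end Perspective

/-- **A convex positively homogeneous regular mapping is the perspective of its restriction.**
If `F` is a convex, positively homogeneous regular mapping of `(k+1)`-tuples of positive
definite invertible operators into self-adjoint operators, and `G(A₁,…,Aₖ) = F(A₁,…,Aₖ,1)`,
then `F(A₁,…,Aₖ,B) = B^{1/2} G(B^{-1/2}A₁B^{-1/2},…,B^{-1/2}AₖB^{-1/2}) B^{1/2}`. -/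
theorem homogeneous_regular_map_is_perspective
    (hH : ¬ FiniteDimensional ℂ H) {k : ℕ}
    (F : (Fin (k + 1) → (H →L[ℂ] H)) → (H →L[ℂ] H))
    (hreg : IsRegularPD F)
    (hsa : ∀ A : Fin (k + 1) → (H →L[ℂ] H), (∀ i, IsPosDefInv (A i)) → IsSelfAdjoint (F A))
    (hconv : ∀ A B : Fin (k + 1) → (H →L[ℂ] H),
      (∀ i, IsPosDefInv (A i)) → (∀ i, IsPosDefInv (B i)) →
      ∀ t : ℝ, 0 ≤ t → t ≤ 1 →
        F (fun i => t • A i + (1 - t) • B i) ≤ t • F A + (1 - t) • F B)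
    (hhom : ∀ t : ℝ, 0 < t → ∀ A : Fin (k + 1) → (H →L[ℂ] H), (∀ i, IsPosDefInv (A i)) →
      F (fun i => t • A i) = t • F A)
    (A : Fin k → (H →L[ℂ] H)) (B : H →L[ℂ] H)
    (hA : ∀ i, IsPosDefInv (A i)) (hB : IsPosDefInv B) :
    F (Fin.snoc A B) =
      CFC.sqrt B *
        F (Fin.snoc (fun i => CFC.sqrt (Ring.inverse B) * A i * CFC.sqrt (Ring.inverse B)) 1) *
        CFC.sqrt B := by
  have hsB : IsPosDefInv (CFC.sqrt B) :=
    ⟨CFC.sqrt_nonneg _, IsStrictlyPositive.isUnit_cfcSqrt (A := H →L[ℂ] H) _ hB⟩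
  obtain ⟨d, hd, hcd, hdc⟩ := hsB.exists_inverse
  have hinv : CFC.sqrt (Ring.inverse B) = d := by
    rw [CFC.sqrt_ringInverse]
    exact (left_inv_eq_right_inv hdc (Ring.mul_inverse_cancel _ hsB.2)).symm
  have hds : IsSelfAdjoint d := IsSelfAdjoint.of_nonneg hd.1
  have hBB : CFC.sqrt B * CFC.sqrt B = B := CFC.sqrt_mul_sqrt_self _ hB.1
  rw [hinv, ← hreg.map_conj hconv hhom hH hsB]
  · congr 1
    funext i
    refine Fin.lastCases ?_ (fun j => ?_) i
    · simp only [Fin.snoc_last, mul_one, hBB]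
    · simp only [Fin.snoc_castSucc]
      calc A j = CFC.sqrt B * d * A j * (d * CFC.sqrt B) := by rw [hcd, hdc, one_mul, mul_one]
        _ = _ := by simp only [mul_assoc]
  · refine Fin.lastCases ?_ (fun j => ?_)
    · simpa only [Fin.snoc_last] using IsPosDefInv.one
    · simpa only [Fin.snoc_castSucc] using (hA j).conj hds hd.2
end
end

section
/- Let H be an infinite-dimensional complex Hilbert space. For every k ≥ 1, the inductive geometric mean Gₖ is concave: for all k-tuples (A₁,…,Aₖ) and (B₁,…,Bₖ) of positive definite invertible bounded operators on H and all λ ∈ [0,1], Gₖ(λA₁+(1−λ)B₁, …, λAₖ+(1−λ)Bₖ) ≥ λ Gₖ(A₁,…,Aₖ) + (1−λ) Gₖ(B₁,…,Bₖ) in the Loewner order. -/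
set_option synthInstance.maxHeartbeats 400000
set_option maxHeartbeats 1000000

noncomputable section

variable {H : Type*} [NormedAddCommGroup H] [InnerProductSpace ℂ H] [CompleteSpace H]

/-- The inductive geometric mean: `indGM k` is the geometric mean `G_{k+1}` of `k+1`
operator variables, defined recursively by `G₁(A) = A` and
`G_{k+1}(A₁,…,A_{k+1}) = A_{k+1}^{1/2} Gₖ(A_{k+1}^{-1/2}A₁A_{k+1}^{-1/2},…,A_{k+1}^{-1/2}AₖA_{k+1}^{-1/2})^{k/(k+1)} A_{k+1}^{1/2}`,
with fractional powers taken via the continuous functional calculus. -/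
noncomputable def indGM : (k : ℕ) → (Fin (k + 1) → (H →L[ℂ] H)) → (H →L[ℂ] H)
  | 0, A => A 0
  | (k + 1), A =>
      CFC.sqrt (A (Fin.last (k + 1))) *
        CFC.rpow
          (indGM k (fun i : Fin (k + 1) =>
            CFC.sqrt (Ring.inverse (A (Fin.last (k + 1)))) * A i.castSucc *
              CFC.sqrt (Ring.inverse (A (Fin.last (k + 1))))))
          ((k + 1 : ℝ) / (k + 2)) *
        CFC.sqrt (A (Fin.last (k + 1)))

open Set MeasureTheory Ring

section CStar

variable {R : Type*} [CStarAlgebra R] [PartialOrder R] [StarOrderedRing R]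

/-- Jensen's operator inequality for the inverse. -/
theorem ringInverse_conj_add_le {s t : ℝ} (hs : 0 ≤ s) (ht : 0 ≤ t) {S T x y z : R}
    (hST : s • (star S * S) + t • (star T * T) = 1)
    (hz : s • (star S * x * S) + t • (star T * y * T) = z)
    (hx : IsStrictlyPositive x) (hy : IsStrictlyPositive y) (hzp : IsStrictlyPositive z) :
    z⁻¹ʳ ≤ s • (star S * x⁻¹ʳ * S) + t • (star T * y⁻¹ʳ * T) := by
  have hzi : IsSelfAdjoint z⁻¹ʳ := hzp.ringInverse.isSelfAdjoint
  have expand : ∀ {U v : R}, IsStrictlyPositive v →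
      star (U * z⁻¹ʳ - v⁻¹ʳ * U) * v * (U * z⁻¹ʳ - v⁻¹ʳ * U) =
        z⁻¹ʳ * (star U * v * U) * z⁻¹ʳ - z⁻¹ʳ * (star U * U) - (star U * U) * z⁻¹ʳ +
          star U * v⁻¹ʳ * U := by
    intro U v hv
    have h1 := Ring.mul_inverse_cancel v hv.isUnit
    have h2 := Ring.inverse_mul_cancel v hv.isUnit
    have hvi : star v⁻¹ʳ = v⁻¹ʳ := hv.ringInverse.isSelfAdjoint
    calc _ = z⁻¹ʳ * (star U * v * U) * z⁻¹ʳ - z⁻¹ʳ * (star U * (v * v⁻¹ʳ) * U)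
          - (star U * (v⁻¹ʳ * v) * U) * z⁻¹ʳ + star U * (v⁻¹ʳ * v) * v⁻¹ʳ * U := by
          simp only [star_sub, star_mul, hzi.star_eq, hvi]
          noncomm_ring
      _ = _ := by simp only [h1, h2, mul_one]
  have hpos := add_nonneg
    (smul_nonneg hs (star_left_conjugate_nonneg hx.nonneg (S * z⁻¹ʳ - x⁻¹ʳ * S)))
    (smul_nonneg ht (star_left_conjugate_nonneg hy.nonneg (T * z⁻¹ʳ - y⁻¹ʳ * T)))
  rw [← sub_nonneg]
  convert hpos using 1
  rw [expand hx, expand hy]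
  calc _ = z⁻¹ʳ * z * z⁻¹ʳ - z⁻¹ʳ * 1 - 1 * z⁻¹ʳ +
        (s • (star S * x⁻¹ʳ * S) + t • (star T * y⁻¹ʳ * T)) := by
        rw [Ring.inverse_mul_cancel z hzp.isUnit]
        noncomm_ring
    _ = _ := by
        rw [← hST]
        nth_rewrite 2 [← hz]
        simp only [mul_add, add_mul, mul_smul_comm, smul_mul_assoc, smul_add, smul_sub]
        abel

theorem cfcₙ_rpowIntegrand₀₁_eq {p τ : ℝ} (hp : p ∈ Ioo 0 1) (hτ : 0 < τ) {x : R} (hx : 0 ≤ x) :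
    cfcₙ (Real.rpowIntegrand₀₁ p τ) x =
      algebraMap ℝ R (τ ^ (p - 1)) - τ ^ p • (algebraMap ℝ R τ + x)⁻¹ʳ := by
  have hc : ContinuousOn (Real.rpowIntegrand₀₁ p τ) (quasispectrum ℝ x) :=
    (Real.continuousOn_rpowIntegrand₀₁_Ici hp hτ).mono (by grind)
  rw [cfcₙ_eq_cfc hc Real.rpowIntegrand₀₁_zero_right, Real.rpowIntegrand₀₁_eq_sub (by grind) hτ]
  have hspectrum : ∀ r ∈ spectrum ℝ x, τ + r ≠ 0 := by grind
  have hg : ContinuousOn (fun z : ℝ => (τ + z)⁻¹) (spectrum ℝ x) :=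
    (continuousOn_const.add continuousOn_id).inv₀ hspectrum
  have hx' : IsSelfAdjoint x := hx.isSelfAdjoint
  rw [cfc_sub (fun _ : ℝ => τ ^ (p - 1)) (fun z : ℝ => τ ^ p * (τ + z)⁻¹) x
      continuousOn_const (continuousOn_const.mul hg), cfc_const _ x hx',
    cfc_const_mul _ _ x hg, cfc_inv (fun z : ℝ => τ + z) x hspectrum
      (continuousOn_const.add continuousOn_id) hx',
    cfc_const_add τ (fun z => z) x continuousOn_id hx', cfc_id' ℝ x hx']

/-- Jensen's operator inequality for the integrand representing `x ↦ x ^ p`. -/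
theorem conj_add_cfcₙ_rpowIntegrand₀₁_le {p τ : ℝ} (hp : p ∈ Ioo 0 1) (hτ : 0 < τ)
    {s t : ℝ} (hs : 0 ≤ s) (ht : 0 ≤ t) {S T x y : R}
    (hST : s • (star S * S) + t • (star T * T) = 1) (hx : 0 ≤ x) (hy : 0 ≤ y) :
    s • (star S * cfcₙ (Real.rpowIntegrand₀₁ p τ) x * S) +
      t • (star T * cfcₙ (Real.rpowIntegrand₀₁ p τ) y * T) ≤
      cfcₙ (Real.rpowIntegrand₀₁ p τ) (s • (star S * x * S) + t • (star T * y * T)) := by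
  have hz : 0 ≤ s • (star S * x * S) + t • (star T * y * T) :=
    add_nonneg (smul_nonneg hs (star_left_conjugate_nonneg hx S))
      (smul_nonneg ht (star_left_conjugate_nonneg hy T))
  rw [cfcₙ_rpowIntegrand₀₁_eq hp hτ hx, cfcₙ_rpowIntegrand₀₁_eq hp hτ hy,
    cfcₙ_rpowIntegrand₀₁_eq hp hτ hz]
  have hshift : ∀ v : R, 0 ≤ v → IsStrictlyPositive (algebraMap ℝ R τ + v) := by grind
  have hJ := ringInverse_conj_add_le (x := algebraMap ℝ R τ + x) (y := algebraMap ℝ R τ + y)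
    (z := algebraMap ℝ R τ + (s • (star S * x * S) + t • (star T * y * T)))
    hs ht hST ?_ (hshift x hx) (hshift y hy) (hshift _ hz)
  · have hJ' := smul_le_smul_of_nonneg_left hJ (Real.rpow_nonneg hτ.le p)
    have hc : algebraMap ℝ R (τ ^ (p - 1)) =
        s • (star S * algebraMap ℝ R (τ ^ (p - 1)) * S) +
          t • (star T * algebraMap ℝ R (τ ^ (p - 1)) * T) := by
      rw [Algebra.algebraMap_eq_smul_one]
      nth_rewrite 1 [← hST]
      simp only [mul_smul_comm, smul_mul_assoc, mul_one, smul_add, smul_comm (τ ^ (p - 1))]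
    refine le_trans (le_of_eq ?_) (sub_le_sub_left hJ' _)
    nth_rewrite 3 [hc]
    simp only [mul_sub, sub_mul, mul_smul_comm, smul_mul_assoc, smul_add, smul_sub,
      smul_comm (τ ^ p)]
    abel
  · rw [Algebra.algebraMap_eq_smul_one]
    nth_rewrite 3 [← hST]
    simp only [mul_add, add_mul, mul_smul_comm, smul_mul_assoc, mul_one, smul_add,
      smul_comm τ]
    abel

/-- Jensen's operator inequality for `x ↦ x ^ p` with `p ∈ (0, 1)`. -/
theorem conj_add_rpow_le {p : ℝ} (hp : p ∈ Ioo 0 1)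
    {s t : ℝ} (hs : 0 ≤ s) (ht : 0 ≤ t) {S T x y : R}
    (hST : s • (star S * S) + t • (star T * T) = 1) (hx : 0 ≤ x) (hy : 0 ≤ y) :
    s • (star S * x ^ p * S) + t • (star T * y ^ p * T) ≤
      (s • (star S * x * S) + t • (star T * y * T)) ^ p := by
  lift p to NNReal using hp.1.le
  have hp' : p ∈ Ioo 0 1 := by simpa using hp
  have hz : 0 ≤ s • (star S * x * S) + t • (star T * y * T) :=
    add_nonneg (smul_nonneg hs (star_left_conjugate_nonneg hx S))
      (smul_nonneg ht (star_left_conjugate_nonneg hy T))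
  obtain ⟨μ, hμ⟩ := CFC.exists_measure_nnrpow_eq_integral_cfcₙ_rpowIntegrand₀₁ R hp'
  simp only [← CFC.nnrpow_eq_rpow hp'.1]
  let L (r : ℝ) (U : R) : R →L[ℝ] R :=
    r • (ContinuousLinearMap.mulLeftRight ℝ R (star U) U)
  have hL : ∀ r U v, L r U v = r • (star U * v * U) := fun r U v => rfl
  rw [(hμ _ hx).2, (hμ _ hy).2, (hμ _ hz).2, ← hL, ← hL,
    ← (L s S).integral_comp_comm (hμ _ hx).1, ← (L t T).integral_comp_comm (hμ _ hy).1,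
    ← integral_add ((L s S).integrable_comp (hμ _ hx).1) ((L t T).integrable_comp (hμ _ hy).1)]
  refine integral_mono_ae (((L s S).integrable_comp (hμ _ hx).1).add
    ((L t T).integrable_comp (hμ _ hy).1)) (hμ _ hz).1 ?_
  filter_upwards [ae_restrict_mem measurableSet_Ioi] with τ hτ
  exact conj_add_cfcₙ_rpowIntegrand₀₁_le hp hτ hs ht hST hx hy

theorem sqrt_mul_sqrt_ringInverse {a : R} (ha : IsStrictlyPositive a) :
    CFC.sqrt a * CFC.sqrt a⁻¹ʳ = 1 := by
  rw [CFC.sqrt_ringInverse]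
  exact Ring.mul_inverse_cancel _ ha.isUnit_cfcSqrt

theorem sqrt_ringInverse_mul_sqrt {a : R} (ha : IsStrictlyPositive a) :
    CFC.sqrt a⁻¹ʳ * CFC.sqrt a = 1 := by
  rw [CFC.sqrt_ringInverse]
  exact Ring.inverse_mul_cancel _ ha.isUnit_cfcSqrt

theorem star_sqrt (a : R) : star (CFC.sqrt a) = CFC.sqrt a :=
  (CFC.sqrt_nonneg a).isSelfAdjoint

theorem sqrt_ringInverse_conj_self {a : R} (ha : IsStrictlyPositive a) :
    CFC.sqrt a⁻¹ʳ * a * CFC.sqrt a⁻¹ʳ = 1 := by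
  calc _ = CFC.sqrt a⁻¹ʳ * (CFC.sqrt a * CFC.sqrt a) * CFC.sqrt a⁻¹ʳ := by
        rw [CFC.sqrt_mul_sqrt_self a ha.nonneg]
    _ = (CFC.sqrt a⁻¹ʳ * CFC.sqrt a) * (CFC.sqrt a * CFC.sqrt a⁻¹ʳ) := by noncomm_ring
    _ = 1 := by rw [sqrt_ringInverse_mul_sqrt ha, sqrt_mul_sqrt_ringInverse ha, mul_one]

theorem IsStrictlyPositive.star_left_conj {a c : R} (ha : IsStrictlyPositive a) (hc : IsUnit c) :
    IsStrictlyPositive (star c * a * c) :=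
  ⟨star_left_conjugate_nonneg ha.nonneg c, (hc.star.mul ha.isUnit).mul hc⟩

theorem IsStrictlyPositive.smul_add_smul {s t : ℝ} (hs : 0 ≤ s) (ht : 0 ≤ t) (hst : s + t = 1)
    {a b : R} (ha : IsStrictlyPositive a) (hb : IsStrictlyPositive b) :
    IsStrictlyPositive (s • a + t • b) := by
  have : Convex ℝ {a : R | IsStrictlyPositive a} := by grind [convex_iff_forall_pos]
  exact this ha hb hs ht hst

theorem star_unitary_conj_rpow {p : ℝ} (hp : 0 ≤ p) {x : R} (hx : 0 ≤ x) (u : unitary R) :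
    (star (u : R) * x * u) ^ p = star (u : R) * x ^ p * u := by
  have h := StarAlgHomClass.map_cfc (S := ℂ) (Unitary.conjStarAlgAut ℂ R (star u))
    (fun r : NNReal => r ^ p) x (NNReal.continuous_rpow_const hp).continuousOn
    (by
      change Continuous fun x : R => ((star u : unitary R) : R) * x * star ((star u : unitary R) : R)
      fun_prop) hx
    (by
      rw [Unitary.conjStarAlgAut_star_apply]
      exact star_left_conjugate_nonneg hx _)
  rw [Unitary.conjStarAlgAut_star_apply, Unitary.conjStarAlgAut_star_apply] at h
  exact h.symm

/-- The weighted geometric mean `a #ₚ b`. -/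
def weightedGeomMean (p : ℝ) (a b : R) : R :=
  CFC.sqrt a * (CFC.sqrt a⁻¹ʳ * b * CFC.sqrt a⁻¹ʳ) ^ p * CFC.sqrt a

theorem weightedGeomMean_mono {p : ℝ} (hp : p ∈ Icc 0 1) (a : R) :
    Monotone (weightedGeomMean p a) := fun _ _ h =>
  conjugate_le_conjugate_of_nonneg
    (CFC.rpow_le_rpow hp (conjugate_le_conjugate_of_nonneg h (CFC.sqrt_nonneg _)))
    (CFC.sqrt_nonneg _)

theorem weightedGeomMean_conj {p : ℝ} (hp : 0 ≤ p) {a b c : R} (ha : IsStrictlyPositive a)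
    (hb : 0 ≤ b) (hc : IsUnit c) :
    weightedGeomMean p (star c * a * c) (star c * b * c) =
      star c * weightedGeomMean p a b * c := by
  have ha' := ha.star_left_conj hc
  unfold weightedGeomMean
  set d := star c * a * c with hd
  set u := CFC.sqrt a * c * CFC.sqrt d⁻¹ʳ with hu
  have hustar : star u = CFC.sqrt d⁻¹ʳ * star c * CFC.sqrt a := by
    simp only [hu, star_mul, star_sqrt, mul_assoc]
  have huu : star u * u = 1 := by
    calc star u * u =
        CFC.sqrt d⁻¹ʳ * (star c * (CFC.sqrt a * CFC.sqrt a) * c) * CFC.sqrt d⁻¹ʳ := by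
          rw [hustar, hu]; simp only [mul_assoc]
      _ = 1 := by
          rw [CFC.sqrt_mul_sqrt_self a ha.nonneg, ← hd, sqrt_ringInverse_conj_self ha']
  have hunit : IsUnit u := (ha.isUnit_cfcSqrt.mul hc).mul ha'.ringInverse.isUnit_cfcSqrt
  have huu' : u * star u = 1 := by
    obtain ⟨v, hv⟩ := hunit.exists_right_inv
    rwa [← left_inv_eq_right_inv huu hv] at hv
  have hr : CFC.sqrt a⁻¹ʳ * u = c * CFC.sqrt d⁻¹ʳ := by
    rw [hu, ← mul_assoc, ← mul_assoc, sqrt_ringInverse_mul_sqrt ha, one_mul]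
  have hr' : star u * CFC.sqrt a⁻¹ʳ = CFC.sqrt d⁻¹ʳ * star c := by
    rw [hustar, mul_assoc, sqrt_mul_sqrt_ringInverse ha, mul_one]
  have hl : u * CFC.sqrt d = CFC.sqrt a * c := by
    rw [hu, mul_assoc, sqrt_ringInverse_mul_sqrt ha', mul_one]
  have hl' : CFC.sqrt d * star u = star c * CFC.sqrt a := by
    rw [hustar, ← mul_assoc, ← mul_assoc, sqrt_mul_sqrt_ringInverse ha', one_mul]
  have hX : CFC.sqrt d⁻¹ʳ * (star c * b * c) * CFC.sqrt d⁻¹ʳ =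
      star u * (CFC.sqrt a⁻¹ʳ * b * CFC.sqrt a⁻¹ʳ) * u := by
    calc _ = (CFC.sqrt d⁻¹ʳ * star c) * b * (c * CFC.sqrt d⁻¹ʳ) := by simp only [mul_assoc]
      _ = _ := by rw [← hr, ← hr']; simp only [mul_assoc]
  rw [hX, star_unitary_conj_rpow hp (conjugate_nonneg_of_nonneg hb (CFC.sqrt_nonneg _))
    ⟨u, Unitary.mem_iff.mpr ⟨huu, huu'⟩⟩]
  generalize (CFC.sqrt a⁻¹ʳ * b * CFC.sqrt a⁻¹ʳ) ^ p = y
  calc _ = (CFC.sqrt d * star u) * y * (u * CFC.sqrt d) := by simp only [mul_assoc]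
    _ = _ := by rw [hl, hl']; simp only [mul_assoc]

/-- The weighted geometric mean is jointly concave. -/
theorem weightedGeomMean_concave {p : ℝ} (hp : p ∈ Ioo 0 1) {s t : ℝ} (hs : 0 ≤ s) (ht : 0 ≤ t)
    (hst : s + t = 1) {a₁ a₂ b₁ b₂ : R} (ha₁ : IsStrictlyPositive a₁)
    (ha₂ : IsStrictlyPositive a₂) (hb₁ : 0 ≤ b₁) (hb₂ : 0 ≤ b₂) :
    s • weightedGeomMean p a₁ b₁ + t • weightedGeomMean p a₂ b₂ ≤
      weightedGeomMean p (s • a₁ + t • a₂) (s • b₁ + t • b₂) := by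
  have ha := ha₁.smul_add_smul hs ht hst ha₂
  set a := s • a₁ + t • a₂ with ha_def
  set r := CFC.sqrt a⁻¹ʳ with hr
  have hrstar : star r = r := star_sqrt _
  have hstar : ∀ v : R, star (CFC.sqrt v * r) = r * CFC.sqrt v := fun v => by
    rw [star_mul, hrstar, star_sqrt]
  have hsq : ∀ v : R, IsStrictlyPositive v →
      star (CFC.sqrt v * r) * (CFC.sqrt v * r) = r * v * r := fun v hv => by
    calc _ = r * (CFC.sqrt v * CFC.sqrt v) * r := by rw [hstar]; simp only [mul_assoc]
      _ = _ := by rw [CFC.sqrt_mul_sqrt_self v hv.nonneg]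
  have hconj : ∀ v b : R, IsStrictlyPositive v →
      star (CFC.sqrt v * r) * (CFC.sqrt v⁻¹ʳ * b * CFC.sqrt v⁻¹ʳ) * (CFC.sqrt v * r) =
        r * b * r := fun v b hv => by
    calc _ = r * (CFC.sqrt v * CFC.sqrt v⁻¹ʳ) * b * (CFC.sqrt v⁻¹ʳ * CFC.sqrt v) * r := by
          rw [hstar]; simp only [mul_assoc]
      _ = _ := by
          rw [sqrt_mul_sqrt_ringInverse hv, sqrt_ringInverse_mul_sqrt hv, mul_one, mul_one]
  have hback : ∀ v y : R,
      CFC.sqrt a * (star (CFC.sqrt v * r) * y * (CFC.sqrt v * r)) * CFC.sqrt a =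
        CFC.sqrt v * y * CFC.sqrt v := fun v y => by
    calc _ = (CFC.sqrt a * r) * CFC.sqrt v * y * CFC.sqrt v * (r * CFC.sqrt a) := by
          rw [hstar]; simp only [mul_assoc]
      _ = _ := by
          rw [hr, sqrt_mul_sqrt_ringInverse ha, sqrt_ringInverse_mul_sqrt ha, one_mul, mul_one]
  have hone : s • (star (CFC.sqrt a₁ * r) * (CFC.sqrt a₁ * r)) +
      t • (star (CFC.sqrt a₂ * r) * (CFC.sqrt a₂ * r)) = 1 := by
    rw [hsq _ ha₁, hsq _ ha₂, ← sqrt_ringInverse_conj_self ha, ← hr, ha_def]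
    simp only [mul_add, add_mul, mul_smul_comm, smul_mul_assoc]
  have hJ := conj_add_rpow_le hp hs ht hone
    (conjugate_nonneg_of_nonneg hb₁ (CFC.sqrt_nonneg a₁⁻¹ʳ))
    (conjugate_nonneg_of_nonneg hb₂ (CFC.sqrt_nonneg a₂⁻¹ʳ))
  have hJ' := conjugate_le_conjugate_of_nonneg hJ (CFC.sqrt_nonneg a)
  rw [hconj _ _ ha₁, hconj _ _ ha₂, mul_add, add_mul] at hJ'
  simp only [mul_smul_comm, smul_mul_assoc, hback] at hJ'
  refine hJ'.trans (le_of_eq ?_)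
  simp only [weightedGeomMean, ← hr, mul_add, add_mul, mul_smul_comm, smul_mul_assoc]

end CStar

theorem indGM_nonneg {k : ℕ} {A : Fin (k + 1) → (H →L[ℂ] H)}
    (hA : ∀ i, IsStrictlyPositive (A i)) :
    0 ≤ indGM k A := by
  cases k with
  | zero => exact (hA 0).nonneg
  | succ k => exact conjugate_nonneg_of_nonneg CFC.rpow_nonneg (CFC.sqrt_nonneg _)

theorem indGM_succ_of_conj {k : ℕ} {A : Fin (k + 2) → (H →L[ℂ] H)}
    (hA : ∀ i, IsStrictlyPositive (A i))
    (hconj : ∀ C : H →L[ℂ] H, IsUnit C →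
      indGM k (fun i => star C * A i.castSucc * C) =
        star C * indGM k (fun i => A i.castSucc) * C) :
    indGM (k + 1) A = weightedGeomMean ((k + 1 : ℝ) / (k + 2)) (A (Fin.last (k + 1)))
      (indGM k (fun i => A i.castSucc)) := by
  have h := hconj _ (hA (Fin.last (k + 1))).ringInverse.isUnit_cfcSqrt
  rw [star_sqrt] at h
  rw [indGM, h]
  rfl

theorem exponent_mem_Ioo (k : ℕ) : (k + 1 : ℝ) / (k + 2) ∈ Ioo (0 : ℝ) 1 :=
  ⟨by positivity, by rw [div_lt_one (by positivity)]; linarith⟩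

theorem indGM_conj {k : ℕ} {A : Fin (k + 1) → (H →L[ℂ] H)} (hA : ∀ i, IsStrictlyPositive (A i))
    {C : H →L[ℂ] H} (hC : IsUnit C) :
    indGM k (fun i => star C * A i * C) = star C * indGM k A * C := by
  induction k generalizing C with
  | zero => rfl
  | succ k ih =>
    have hA' : ∀ i : Fin (k + 1), IsStrictlyPositive (A i.castSucc) := fun i => hA _
    have hCA : ∀ i, IsStrictlyPositive (star C * A i * C) := fun i => (hA i).star_left_conj hC
    rw [indGM_succ_of_conj hCA fun _ hD => ih (fun i => hCA i.castSucc) hD,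
      indGM_succ_of_conj hA fun _ hD => ih hA' hD, ih hA' hC,
      weightedGeomMean_conj (exponent_mem_Ioo k).1.le (hA _) (indGM_nonneg hA') hC]

theorem indGM_succ {k : ℕ} {A : Fin (k + 2) → (H →L[ℂ] H)} (hA : ∀ i, IsStrictlyPositive (A i)) :
    indGM (k + 1) A = weightedGeomMean ((k + 1 : ℝ) / (k + 2)) (A (Fin.last (k + 1)))
      (indGM k (fun i => A i.castSucc)) :=
  indGM_succ_of_conj hA fun _ hC => indGM_conj (fun _ => hA _) hC

/-- **Concavity of the inductive geometric mean.** For every `k ≥ 1` (here `Gₖ` is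
`indGM (k-1)`, a mean of `k+1` variables for each `k : ℕ`), the inductive geometric mean is
concave in the Loewner order. -/
theorem indGM_concave
    (hH : ¬ FiniteDimensional ℂ H) (k : ℕ)
    (A B : Fin (k + 1) → (H →L[ℂ] H))
    (hA : ∀ i, IsPosDefInv (A i)) (hB : ∀ i, IsPosDefInv (B i))
    (t : ℝ) (ht0 : 0 ≤ t) (ht1 : t ≤ 1) :
    t • indGM k A + (1 - t) • indGM k B ≤ indGM k (fun i => t • A i + (1 - t) • B i) := by
  induction k with
  | zero => exact le_rfl
  | succ k ih =>
    have hst : t + (1 - t) = 1 := by ring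
    have ht1' : 0 ≤ 1 - t := sub_nonneg.mpr ht1
    have hAB : ∀ i, IsStrictlyPositive (t • A i + (1 - t) • B i) := fun i =>
      IsStrictlyPositive.smul_add_smul ht0 ht1' hst (hA i) (hB i)
    have hp := exponent_mem_Ioo k
    rw [indGM_succ hA, indGM_succ hB, indGM_succ hAB]
    exact (weightedGeomMean_concave hp ht0 ht1' hst (hA _) (hB _) (indGM_nonneg fun _ => hA _)
      (indGM_nonneg fun _ => hB _)).trans
      (weightedGeomMean_mono (Ioo_subset_Icc_self hp) _ (ih _ _ (fun _ => hA _) fun _ => hB _))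
end
end
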